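/- Let G be an s-bridgeless 2-edge-connected signed graph whose negativeness ε_N(G) is positive and even, with vertex set V and edge set E. Then SCC(G) ≤ |E| + 2|V| + z₂, where z₂ = min{ (2/3)|E| + (1/3)ε_N(G) − 4 , |V| + ε_N(G) − 5 }. -/

import Mathlib

open scoped Classical

noncomputable section

/-- A signed (multi)graph: a finite multigraph (loops and multiple edges allowed)
together with a sign on each edge (`neg e = true` means `e` is negative). -/
structure SignedMultigraph where
  V : Type
  E : Type
  [fintypeV : Fintype V]
  [fintypeE : Fintype E]
  ends : E → Sym2 V
  neg : E → Bool

attribute [instance] SignedMultigraph.fintypeV SignedMultigraph.fintypeE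

namespace SignedMultigraph

variable (G : SignedMultigraph)

/-- The vertices incident with at least one edge of `S`. -/
def support (S : Finset G.E) : Finset G.V :=
  Finset.univ.filter fun v => ∃ e ∈ S, v ∈ G.ends e

/-- Degree of `v` in the edge set `S`; loops count twice. -/
def degIn (S : Finset G.E) (v : G.V) : ℕ :=
  ∑ e ∈ S, (if G.ends e = Sym2.diag v then 2 else if v ∈ G.ends e then 1 else 0)

/-- `u` and `v` are joined by an edge of `S`. -/
def Adj (S : Finset G.E) (u v : G.V) : Prop := ∃ e ∈ S, G.ends e = s(u, v)

/-- Reachability using only edges of `S`. -/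
def Reach (S : Finset G.E) : G.V → G.V → Prop := Relation.ReflTransGen (G.Adj S)

/-- The subgraph with edge set `S` (and vertex set its support) is connected. -/
def ConnOn (S : Finset G.E) : Prop :=
  ∀ u ∈ G.support S, ∀ v ∈ G.support S, G.Reach S u v

/-- The whole signed graph is connected. -/
def Connected : Prop := Nonempty G.V ∧ ∀ u v : G.V, G.Reach Finset.univ u v

/-- The negative edges among `S`. -/
def negEdges (S : Finset G.E) : Finset G.E := S.filter fun e => G.neg e = true

/-- A circuit: a (nonempty) connected 2-regular subgraph, given by its edge set. -/
def IsCircuit (S : Finset G.E) : Prop :=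
  S.Nonempty ∧ G.ConnOn S ∧ ∀ v ∈ G.support S, G.degIn S v = 2

/-- A balanced circuit: a circuit with an even number of negative edges. -/
def IsBalancedCircuit (S : Finset G.E) : Prop :=
  G.IsCircuit S ∧ Even (G.negEdges S).card

/-- An unbalanced circuit: a circuit with an odd number of negative edges. -/
def IsUnbalancedCircuit (S : Finset G.E) : Prop :=
  G.IsCircuit S ∧ ¬ Even (G.negEdges S).card

/-- A short barbell: two unbalanced circuits meeting at exactly one vertex. -/
def IsShortBarbell (S : Finset G.E) : Prop :=
  ∃ C₁ C₂ : Finset G.E, G.IsUnbalancedCircuit C₁ ∧ G.IsUnbalancedCircuit C₂ ∧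
    Disjoint C₁ C₂ ∧ (G.support C₁ ∩ G.support C₂).card = 1 ∧ S = C₁ ∪ C₂

/-- A path with (distinct) ends `u` and `v`, given by its edge set. -/
def IsPath (P : Finset G.E) (u v : G.V) : Prop :=
  P.Nonempty ∧ G.ConnOn P ∧ u ≠ v ∧ u ∈ G.support P ∧ v ∈ G.support P ∧
    G.degIn P u = 1 ∧ G.degIn P v = 1 ∧
    ∀ w ∈ G.support P, w ≠ u → w ≠ v → G.degIn P w = 2

/-- A long barbell: two vertex-disjoint unbalanced circuits joined by a path
meeting the circuits only at its ends. -/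
def IsLongBarbell (S : Finset G.E) : Prop :=
  ∃ (C₁ C₂ P : Finset G.E) (u v : G.V),
    G.IsUnbalancedCircuit C₁ ∧ G.IsUnbalancedCircuit C₂ ∧
    Disjoint (G.support C₁) (G.support C₂) ∧
    G.IsPath P u v ∧
    G.support P ∩ G.support C₁ = {u} ∧ G.support P ∩ G.support C₂ = {v} ∧
    Disjoint P C₁ ∧ Disjoint P C₂ ∧
    S = C₁ ∪ C₂ ∪ P

/-- A signed circuit: a balanced circuit, a short barbell, or a long barbell. -/
def IsSignedCircuit (S : Finset G.E) : Prop :=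
  G.IsBalancedCircuit S ∨ G.IsShortBarbell S ∨ G.IsLongBarbell S

/-- The number of members of the family `F` containing the edge `e`. -/
def coverCount (F : Multiset (Finset G.E)) (e : G.E) : ℕ :=
  (F.filter fun S => e ∈ S).card

/-- The total length of the family `F`. -/
def coverLength (F : Multiset (Finset G.E)) : ℕ := (F.map Finset.card).sum

/-- A signed circuit cover: every edge is in at least one member. -/
def IsSignedCircuitCover (F : Multiset (Finset G.E)) : Prop :=
  (∀ S ∈ F, G.IsSignedCircuit S) ∧ ∀ e : G.E, 1 ≤ G.coverCount F e

/-- The length of a shortest signed circuit cover. -/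
def SCC : ℕ := sInf { n | ∃ F, G.IsSignedCircuitCover F ∧ G.coverLength F = n }

/-- Whether edge `e` has exactly one endpoint in the vertex set `A`. -/
def crossesB (A : Finset G.V) (e : G.E) : Bool :=
  Sym2.lift ⟨fun x y => Bool.xor (decide (x ∈ A)) (decide (y ∈ A)),
    fun x y => Bool.xor_comm _ _⟩ (G.ends e)

/-- Sign of `e` (`true` = negative) after switching at every vertex of `A`. -/
def negAfter (A : Finset G.V) (e : G.E) : Bool :=
  Bool.xor (G.neg e) (G.crossesB A e)

/-- Minimum number of negative edges in `S` over all switchings. -/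
def negOf (S : Finset G.E) : ℕ :=
  sInf { n | ∃ A : Finset G.V, (S.filter fun e => G.negAfter A e = true).card = n }

/-- The negativeness of `G`. -/
def negativeness : ℕ := G.negOf Finset.univ

/-- The edges of `S` with exactly one endpoint in `U`: the edge boundary `δ(U)` inside `S`. -/
def boundary (S : Finset G.E) (U : Finset G.V) : Finset G.E :=
  S.filter fun e => G.crossesB U e = true

/-- `b` is a bridge of the subgraph with edge set `S`. -/
def IsBridge (S : Finset G.E) (b : G.E) : Prop :=
  ∃ U : Finset G.V, G.boundary S U = {b}

/-- The subgraph with edge set `S` is bridgeless. -/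
def Bridgeless (S : Finset G.E) : Prop := ∀ b ∈ S, ¬ G.IsBridge S b

/-- `G` is 2-edge-connected. -/
def TwoEdgeConnected : Prop :=
  G.Connected ∧ ∀ b : G.E, ¬ G.IsBridge Finset.univ b

/-- Edges of `S` lying in the same component (of the subgraph with edge set `S`)
as the vertex `x`. -/
def compEdges (S : Finset G.E) (x : G.V) : Finset G.E :=
  S.filter fun e => ∃ u, u ∈ G.ends e ∧ G.Reach S x u

/-- A g-bridge: a bridge such that both components of `G - b` have even negativeness. -/
def IsGBridge (b : G.E) : Prop :=
  G.IsBridge Finset.univ b ∧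
    ∃ x y : G.V, G.ends b = s(x, y) ∧
      Even (G.negOf (G.compEdges (Finset.univ.erase b) x)) ∧
      Even (G.negOf (G.compEdges (Finset.univ.erase b) y))

/-- `G` has no g-bridge (in any of its components). -/
def GBridgeless : Prop := ∀ b : G.E, ¬ G.IsGBridge b

/-- Member of `B_g(G)`: a bridge such that at least one component of `G - b`
contains an odd number of negative edges. -/
def IsBgBridge (b : G.E) : Prop :=
  G.IsBridge Finset.univ b ∧
    ∃ x : G.V, x ∈ G.ends b ∧
      ¬ Even (G.negEdges (G.compEdges (Finset.univ.erase b) x)).card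

/-- Member of `B_s(G)`: a bridge such that each of the two components of `G - b`
contains a negative edge. -/
def IsSBridge (b : G.E) : Prop :=
  G.IsBridge Finset.univ b ∧
    ∃ x y : G.V, G.ends b = s(x, y) ∧
      (G.negEdges (G.compEdges (Finset.univ.erase b) x)).Nonempty ∧
      (G.negEdges (G.compEdges (Finset.univ.erase b) y)).Nonempty

/-- `G` is s-bridgeless: every edge lies in some signed circuit. -/
def SBridgeless : Prop := ∀ e : G.E, ∃ S : Finset G.E, G.IsSignedCircuit S ∧ e ∈ S

/-- `{e, f}` is a 2-edge-cut of `G`. -/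
def IsTwoEdgeCut (e f : G.E) : Prop :=
  e ≠ f ∧ ∃ U : Finset G.V, G.boundary Finset.univ U = {e, f}

/-- `S_G(e) = {e} ∪ {f : {e,f} is a 2-edge-cut of G}`. -/
def SSet (e : G.E) : Finset G.E :=
  insert e (Finset.univ.filter fun f => G.IsTwoEdgeCut e f)

/-- The edge set `R` spans an acyclic subgraph (every nonempty subset has a
vertex of degree one). -/
def AcyclicSet (R : Finset G.E) : Prop :=
  ∀ F ⊆ R, F.Nonempty → ∃ v : G.V, G.degIn F v = 1

/-- `T` is the edge set of a spanning tree of `G`. -/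
def IsSpanningTree (T : Finset G.E) : Prop :=
  G.AcyclicSet T ∧ Nonempty G.V ∧ ∀ u v : G.V, G.Reach T u v

/-- `G` is eulerian: connected with all degrees even. -/
def Eulerian : Prop :=
  G.Connected ∧ ∀ v : G.V, Even (G.degIn Finset.univ v)

/-- The edge set `S` spans an eulerian subgraph. -/
def IsEulerianSub (S : Finset G.E) : Prop :=
  S.Nonempty ∧ G.ConnOn S ∧ ∀ v ∈ G.support S, Even (G.degIn S v)

/-- The vertex class of `v` after contracting each member of `ℬ`. -/
def classOf (ℬ : Finset (Finset G.E)) (v : G.V) : Finset G.V :=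
  Finset.univ.filter fun u => u = v ∨ ∃ B ∈ ℬ, v ∈ G.support B ∧ u ∈ G.support B

/-- Degree, in edge set `F`, of the contracted class of `v`. -/
def classDeg (ℬ : Finset (Finset G.E)) (F : Finset G.E) (v : G.V) : ℕ :=
  ∑ u ∈ G.classOf ℬ v, G.degIn F u

/-- `ℬ` witnesses that the subgraph with edge set `S` is a generalized barbell:
`ℬ` is a family of vertex-disjoint eulerian subgraphs of `S`, the contraction
`S/(∪ℬ)` is acyclic, and for every vertex `x` of the contracted graph,
`|E_N(B_x)| ≡ |δ(V(B_x))| (mod 2)`. -/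
def GenBarbellWitness (S : Finset G.E) (ℬ : Finset (Finset G.E)) : Prop :=
  (∀ B ∈ ℬ, B ⊆ S ∧ G.IsEulerianSub B) ∧
  (∀ B₁ ∈ ℬ, ∀ B₂ ∈ ℬ, B₁ ≠ B₂ → Disjoint (G.support B₁) (G.support B₂)) ∧
  (∀ F ⊆ S \ ℬ.sup id, F.Nonempty → ∃ v : G.V, G.classDeg ℬ F v = 1) ∧
  (∀ B ∈ ℬ, (G.negEdges B).card ≡ (G.boundary S (G.support B)).card [MOD 2]) ∧
  (∀ v ∈ G.support S, (∀ B ∈ ℬ, v ∉ G.support B) → Even (G.boundary S {v}).card)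

/-- The subgraph with edge set `S` is a generalized barbell. -/
def IsGenBarbell (S : Finset G.E) : Prop := ∃ ℬ, G.GenBarbellWitness S ℬ

end SignedMultigraph

namespace SignedMultigraph

variable {G : SignedMultigraph}

/-- The number of ends of `e` at `v` (a loop has two). -/
def edgeDeg (G : SignedMultigraph) (e : G.E) (v : G.V) : ℕ :=
  if G.ends e = Sym2.diag v then 2 else if v ∈ G.ends e then 1 else 0

/-- The incidence vector of an edge over `ZMod 2`. -/
def inc (G : SignedMultigraph) (e : G.E) : G.V → ZMod 2 := fun v => (G.edgeDeg e v : ZMod 2)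

/-- The boundary of an edge set over `ZMod 2`: the parities of its degrees. -/
def bd (G : SignedMultigraph) (S : Finset G.E) : G.V → ZMod 2 := ∑ e ∈ S, G.inc e

theorem degIn_eq_sum (S : Finset G.E) (v : G.V) : G.degIn S v = ∑ e ∈ S, G.edgeDeg e v := rfl

theorem exists_ends (e : G.E) : ∃ x y, G.ends e = s(x, y) := by
  induction h : G.ends e with
  | h x y => exact ⟨x, y, rfl⟩

theorem edgeDeg_eq {e : G.E} {x y : G.V} (h : G.ends e = s(x, y)) (v : G.V) :
    G.edgeDeg e v = (if v = x then 1 else 0) + (if v = y then 1 else 0) := by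
  unfold edgeDeg
  rw [h]
  by_cases h1 : v = x <;> by_cases h2 : v = y <;> simp [Sym2.diag, h1, h2]
  · subst h1; subst h2; simp
  · subst h1; simp [Ne.symm h2, h2]
  · subst h2; simp [h1, Ne.symm h1]
  · exact fun hx => absurd hx.symm h1

theorem edgeDeg_pos_iff {e : G.E} {v : G.V} : 0 < G.edgeDeg e v ↔ v ∈ G.ends e := by
  obtain ⟨x, y, h⟩ := exists_ends e
  rw [edgeDeg_eq h, h, Sym2.mem_iff]
  split_ifs <;> simp_all

theorem inc_eq {e : G.E} {x y : G.V} (h : G.ends e = s(x, y)) :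
    G.inc e = Pi.single x 1 + Pi.single y 1 := by
  funext v
  simp only [inc, edgeDeg_eq h, Pi.add_apply, Pi.single_apply]
  push_cast
  rfl

theorem bd_apply (S : Finset G.E) (v : G.V) : G.bd S v = (G.degIn S v : ZMod 2) := by
  simp [bd, inc, degIn_eq_sum, Finset.sum_apply]

theorem add_self_zmod2 {ι : Type*} (f : ι → ZMod 2) : f + f = 0 := by
  funext i
  exact CharTwo.add_self_eq_zero (f i)

theorem bd_union {S T : Finset G.E} (h : Disjoint S T) : G.bd (S ∪ T) = G.bd S + G.bd T :=
  Finset.sum_union h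

theorem bd_sdiff {S T : Finset G.E} (h : T ⊆ S) : G.bd (S \ T) = G.bd S + G.bd T := by
  have h1 : G.bd (S \ T) + G.bd T = G.bd S := Finset.sum_sdiff h
  rw [← h1, add_assoc, add_self_zmod2, add_zero]

theorem bd_symmDiff (S T : Finset G.E) : G.bd (symmDiff S T) = G.bd S + G.bd T := by
  have h1 : symmDiff S T = S \ T ∪ T \ S := rfl
  have h2 : G.bd (S \ T) + G.bd (S ∩ T) = G.bd S := by
    rw [← bd_union (Finset.disjoint_sdiff_inter S T), Finset.sdiff_union_inter]
  have h3 : G.bd (T \ S) + G.bd (S ∩ T) = G.bd T := by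
    rw [Finset.inter_comm, ← bd_union (Finset.disjoint_sdiff_inter T S), Finset.sdiff_union_inter]
  rw [h1, bd_union disjoint_sdiff_sdiff, ← h2, ← h3]
  have := add_self_zmod2 (G.bd (S ∩ T))
  rw [add_add_add_comm, this, add_zero]

@[simp] theorem bd_empty : G.bd ∅ = 0 := Finset.sum_empty

theorem sum_inc (U : Finset G.V) (e : G.E) :
    ∑ v ∈ U, G.inc e v = if G.crossesB U e = true then 1 else 0 := by
  obtain ⟨x, y, h⟩ := exists_ends e
  rw [inc_eq h]
  simp only [Pi.add_apply, Finset.sum_add_distrib, Finset.sum_pi_single', crossesB, h, Sym2.lift_mk]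
  by_cases hx : x ∈ U <;> by_cases hy : y ∈ U <;> simp [hx, hy, CharTwo.add_self_eq_zero]

theorem sum_bd (S : Finset G.E) (U : Finset G.V) :
    ∑ v ∈ U, G.bd S v = ((G.boundary S U).card : ZMod 2) := by
  simp only [bd, Finset.sum_apply]
  rw [Finset.sum_comm]
  simp only [sum_inc, boundary]
  rw [Finset.sum_boole]

theorem even_boundary {S : Finset G.E} (h : G.bd S = 0) (U : Finset G.V) :
    Even (G.boundary S U).card := by
  rw [← ZMod.natCast_eq_zero_iff_even, ← sum_bd, h]
  simp

theorem crossesB_eq_true {U : Finset G.V} {e : G.E} {x y : G.V} (h : G.ends e = s(x, y)) :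
    G.crossesB U e = true ↔ ¬ (x ∈ U ↔ y ∈ U) := by
  simp only [crossesB, h, Sym2.lift_mk]
  by_cases hx : x ∈ U <;> by_cases hy : y ∈ U <;> simp [hx, hy]

/-! ### Supports, degrees, reachability -/

theorem mem_support {S : Finset G.E} {v : G.V} : v ∈ G.support S ↔ ∃ e ∈ S, v ∈ G.ends e := by
  simp [support]

theorem support_union (S T : Finset G.E) : G.support (S ∪ T) = G.support S ∪ G.support T := by
  ext v
  simp only [mem_support, Finset.mem_union]
  grind

theorem support_mono {S T : Finset G.E} (h : S ⊆ T) : G.support S ⊆ G.support T := by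
  intro v
  simp only [mem_support]
  grind

theorem degIn_pos_iff {S : Finset G.E} {v : G.V} : 0 < G.degIn S v ↔ v ∈ G.support S := by
  rw [degIn_eq_sum, Finset.sum_pos_iff, mem_support]
  simp only [edgeDeg_pos_iff]

theorem degIn_eq_zero {S : Finset G.E} {v : G.V} (h : v ∉ G.support S) : G.degIn S v = 0 := by
  rw [← degIn_pos_iff] at h
  omega

theorem degIn_union {S T : Finset G.E} (h : Disjoint S T) (v : G.V) :
    G.degIn (S ∪ T) v = G.degIn S v + G.degIn T v := Finset.sum_union h

theorem degIn_sdiff_add {S T : Finset G.E} (h : T ⊆ S) (v : G.V) :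
    G.degIn (S \ T) v + G.degIn T v = G.degIn S v := Finset.sum_sdiff h

theorem degIn_singleton {e : G.E} {x y : G.V} (h : G.ends e = s(x, y)) (v : G.V) :
    G.degIn {e} v = (if v = x then 1 else 0) + (if v = y then 1 else 0) := by
  rw [degIn_eq_sum, Finset.sum_singleton, edgeDeg_eq h]

theorem support_singleton {e : G.E} {x y : G.V} (h : G.ends e = s(x, y)) :
    G.support {e} = {x, y} := by
  ext v
  simp [mem_support, h]

theorem Adj.symm {S : Finset G.E} {u v : G.V} (h : G.Adj S u v) : G.Adj S v u := by
  obtain ⟨e, he, h⟩ := h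
  exact ⟨e, he, h.trans Sym2.eq_swap⟩

theorem Reach.symm {S : Finset G.E} {u v : G.V} (h : G.Reach S u v) : G.Reach S v u := by
  induction h with
  | refl => exact .refl
  | tail _ hbc ih => exact Relation.ReflTransGen.head hbc.symm ih

theorem Reach.trans {S : Finset G.E} {u v w : G.V} (h : G.Reach S u v) (h' : G.Reach S v w) :
    G.Reach S u w := Relation.ReflTransGen.trans h h'

theorem Reach.mono {S T : Finset G.E} (hST : S ⊆ T) {u v : G.V} (h : G.Reach S u v) :
    G.Reach T u v := by
  induction h with
  | refl => exact .refl
  | tail _ hbc ih =>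
    obtain ⟨e, he, h⟩ := hbc
    exact ih.tail ⟨e, hST he, h⟩

theorem connOn_of_root {S : Finset G.E} (r : G.V) (h : ∀ u ∈ G.support S, G.Reach S u r) :
    G.ConnOn S := fun u hu v hv => (h u hu).trans (h v hv).symm

theorem reach_of_mem {S : Finset G.E} {e : G.E} (he : e ∈ S) {x y : G.V}
    (h : G.ends e = s(x, y)) : G.Reach S x y := .single ⟨e, he, h⟩

/-- The set of vertices reachable from `r` has no boundary. -/
theorem boundary_reach_eq_empty (S : Finset G.E) (r : G.V) :
    G.boundary S (Finset.univ.filter fun w => G.Reach S r w) = ∅ := by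
  rw [boundary, Finset.filter_eq_empty_iff]
  intro e he hc
  obtain ⟨x, y, h⟩ := exists_ends e
  rw [crossesB_eq_true h] at hc
  simp only [Finset.mem_filter, Finset.mem_univ, true_and] at hc
  exact hc ⟨fun hx => hx.trans (reach_of_mem he h), fun hy => hy.trans (reach_of_mem he h).symm⟩

/-! ### Paths -/

theorem isPath_singleton {e : G.E} {x y : G.V} (h : G.ends e = s(x, y)) (hxy : x ≠ y) :
    G.IsPath {e} x y := by
  have hs := support_singleton h
  refine ⟨by simp, connOn_of_root x ?_, hxy, by simp [hs], by simp [hs], ?_, ?_, ?_⟩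
  · intro u hu
    rw [hs] at hu
    simp only [Finset.mem_insert, Finset.mem_singleton] at hu
    rcases hu with rfl | rfl
    · exact .refl
    · exact (reach_of_mem (by simp) h).symm
  · rw [degIn_singleton h]; simp [hxy]
  · rw [degIn_singleton h]; simp [hxy.symm]
  · intro w hw h1 h2
    rw [hs] at hw
    simp [h1, h2] at hw

theorem IsPath.cons {P : Finset G.E} {u v w : G.V} (hP : G.IsPath P u v) {e : G.E}
    (h : G.ends e = s(w, u)) (hw : w ∉ G.support P) : G.IsPath (insert e P) w v := by
  obtain ⟨hne, hc, huv, hu, hv, hdu, hdv, hd⟩ := hP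
  have heP : Disjoint {e} P := by
    rw [Finset.disjoint_singleton_left]
    intro he
    exact hw (mem_support.2 ⟨e, he, by simp [h]⟩)
  have hwu : w ≠ u := by rintro rfl; exact hw hu
  have hwv : w ≠ v := by rintro rfl; exact hw hv
  rw [Finset.insert_eq]
  have hs : G.support ({e} ∪ P) = {w, u} ∪ G.support P := by
    rw [support_union, support_singleton h]
  have hdeg : ∀ x, G.degIn ({e} ∪ P) x =
      ((if x = w then 1 else 0) + (if x = u then 1 else 0)) + G.degIn P x := fun x => by
    rw [degIn_union heP, degIn_singleton h]
  have hru : ∀ x ∈ G.support P, G.Reach ({e} ∪ P) x u := fun x hx =>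
    (hc x hx u hu).mono Finset.subset_union_right
  refine ⟨by simp, connOn_of_root u ?_, hwv, by rw [hs]; simp, by rw [hs]; simp [hv],
    ?_, ?_, ?_⟩
  · intro x hx
    rw [hs] at hx
    simp only [Finset.mem_union, Finset.mem_insert, Finset.mem_singleton] at hx
    rcases hx with (rfl | rfl) | hx
    · exact reach_of_mem (by simp) h
    · exact .refl
    · exact hru x hx
  · rw [hdeg, degIn_eq_zero hw]; simp [hwu]
  · rw [hdeg, hdv]; simp [hwv.symm, huv.symm]
  · intro x hx hxw hxv
    rw [hdeg]
    by_cases hxu : x = u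
    · subst hxu; simp [hxw, hdu]
    · rw [hs] at hx
      simp only [Finset.mem_union, Finset.mem_insert, Finset.mem_singleton, hxw, hxu,
        or_self, false_or] at hx
      simp [hxw, hxu, hd x hx hxu hxv]

theorem IsPath.bd_eq {P : Finset G.E} {u v : G.V} (hP : G.IsPath P u v) :
    G.bd P = Pi.single u 1 + Pi.single v 1 := by
  obtain ⟨hne, hc, huv, hu, hv, hdu, hdv, hd⟩ := hP
  funext x
  rw [bd_apply, Pi.add_apply, Pi.single_apply, Pi.single_apply]
  by_cases h1 : x = u
  · subst h1; simp [hdu, huv]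
  by_cases h2 : x = v
  · subst h2; simp [hdv, h1]
  by_cases hx : x ∈ G.support P
  · rw [hd x hx h1 h2]; simp [h1, h2]; rfl
  · rw [degIn_eq_zero hx]; simp [h1, h2]

/-- There is a walk with `n` edges in `S` from a vertex to the set `B`. -/
def WalkTo (G : SignedMultigraph) (S : Finset G.E) (B : Finset G.V) : ℕ → G.V → Prop
  | 0, w => w ∈ B
  | n + 1, w => ∃ w', G.Adj S w w' ∧ WalkTo G S B n w'

theorem exists_path_of_walkTo {S : Finset G.E} {B : Finset G.V} (n : ℕ) : ∀ w : G.V,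
    G.WalkTo S B (n + 1) w → (∀ k ≤ n, ¬ G.WalkTo S B k w) →
    ∃ v ∈ B, ∃ P ⊆ S, G.IsPath P w v ∧ (∀ x ∈ G.support P, x ∈ B → x = v) ∧
      ∀ x ∈ G.support P, x ≠ w → ∃ k ≤ n, G.WalkTo S B k x := by
  induction n with
  | zero =>
    rintro w ⟨v, ⟨e, he, h⟩, hv⟩ hw
    have hwB : w ∉ B := hw 0 le_rfl
    have hwv : w ≠ v := by rintro rfl; exact hwB hv
    refine ⟨v, hv, {e}, by simpa using he, isPath_singleton h hwv, ?_, ?_⟩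
    · intro x hx hxB
      rw [support_singleton h] at hx
      simp only [Finset.mem_insert, Finset.mem_singleton] at hx
      rcases hx with rfl | rfl
      · exact absurd hxB hwB
      · rfl
    · intro x hx hxw
      rw [support_singleton h] at hx
      simp only [Finset.mem_insert, Finset.mem_singleton, hxw, false_or] at hx
      subst hx
      exact ⟨0, le_rfl, hv⟩
  | succ n ih =>
    rintro w ⟨w', ⟨e, he, h⟩, hw'⟩ hw
    have hwB : w ∉ B := hw 0 (Nat.zero_le _)
    have hmin : ∀ k ≤ n, ¬ G.WalkTo S B k w' := fun k hk hk' =>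
      hw (k + 1) (by omega) ⟨w', ⟨e, he, h⟩, hk'⟩
    obtain ⟨v, hv, P, hPS, hP, hPB, hPd⟩ := ih w' hw' hmin
    have hwP : w ∉ G.support P := by
      intro hwP
      by_cases hww : w = w'
      · subst hww
        exact hw (n + 1) le_rfl hw'
      · obtain ⟨k, hk, hk'⟩ := hPd w hwP hww
        exact hw k (by omega) hk'
    have hs : G.support (insert e P) = {w, w'} ∪ G.support P := by
      rw [Finset.insert_eq, support_union, support_singleton h]
    have hw'P : w' ∈ G.support P := hP.2.2.2.1
    refine ⟨v, hv, insert e P, Finset.insert_subset he hPS, hP.cons h hwP, ?_, ?_⟩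
    · intro x hx hxB
      rw [hs] at hx
      simp only [Finset.mem_union, Finset.mem_insert, Finset.mem_singleton] at hx
      rcases hx with (rfl | rfl) | hx
      · exact absurd hxB hwB
      · exact hPB _ hw'P hxB
      · exact hPB x hx hxB
    · intro x hx hxw
      rw [hs] at hx
      simp only [Finset.mem_union, Finset.mem_insert, Finset.mem_singleton, hxw, false_or] at hx
      by_cases hxw' : x = w'
      · subst hxw'; exact ⟨n + 1, le_rfl, hw'⟩
      · obtain ⟨k, hk, hk'⟩ := hPd x (by simpa [hxw'] using hx) hxw'
        exact ⟨k, by omega, hk'⟩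

/-- A shortest path between two disjoint vertex sets meets them only at its ends. -/
theorem exists_path_between {S : Finset G.E} {A B : Finset G.V} (hAB : Disjoint A B) {a b : G.V}
    (ha : a ∈ A) (hb : b ∈ B) (h : G.Reach S a b) :
    ∃ u ∈ A, ∃ v ∈ B, ∃ P ⊆ S, G.IsPath P u v ∧ (∀ x ∈ G.support P, x ∈ A → x = u) ∧
      ∀ x ∈ G.support P, x ∈ B → x = v := by
  have hex : ∃ n, ∃ a ∈ A, G.WalkTo S B n a := by
    have : ∃ n, G.WalkTo S B n a := by
      clear ha
      induction h using Relation.ReflTransGen.head_induction_on with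
      | refl => exact ⟨0, hb⟩
      | head h' _ ih =>
        obtain ⟨n, hn⟩ := ih
        exact ⟨n + 1, _, h', hn⟩
    obtain ⟨n, hn⟩ := this
    exact ⟨n, a, ha, hn⟩
  obtain ⟨u, hu, hn⟩ := Nat.find_spec hex
  have hmin : ∀ k < Nat.find hex, ∀ x ∈ A, ¬ G.WalkTo S B k x := fun k hk x hx hk' =>
    Nat.find_min hex hk ⟨x, hx, hk'⟩
  generalize Nat.find hex = n at hn hmin
  cases n with
  | zero => exact absurd hn (Finset.disjoint_left.1 hAB hu)
  | succ n =>
    obtain ⟨v, hv, P, hPS, hP, hPB, hPd⟩ :=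
      exists_path_of_walkTo n u hn fun k hk => hmin k (by omega) u hu
    refine ⟨u, hu, v, hv, P, hPS, hP, ?_, hPB⟩
    intro x hx hxA
    by_contra hxu
    obtain ⟨k, hk, hk'⟩ := hPd x hx hxu
    exact hmin k (by omega) x hxA hk'

theorem exists_path {S : Finset G.E} {u v : G.V} (huv : u ≠ v) (h : G.Reach S u v) :
    ∃ P ⊆ S, G.IsPath P u v := by
  obtain ⟨u', hu', v', hv', P, hPS, hP, -⟩ := exists_path_between
    (Finset.disjoint_singleton.2 huv) (Finset.mem_singleton_self u) (Finset.mem_singleton_self v) h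
  rw [Finset.mem_singleton] at hu' hv'
  subst hu' hv'
  exact ⟨P, hPS, hP⟩

/-! ### Circuits -/

theorem IsCircuit.bd_eq {C : Finset G.E} (h : G.IsCircuit C) : G.bd C = 0 := by
  funext v
  rw [bd_apply]
  by_cases hv : v ∈ G.support C
  · rw [h.2.2 v hv]; rfl
  · rw [degIn_eq_zero hv]; rfl

/-- Two internally disjoint paths with the same ends form a circuit. -/
theorem isCircuit_union_of_isPath {P Q : Finset G.E} {u v : G.V} (hP : G.IsPath P u v)
    (hQ : G.IsPath Q u v) (hd : Disjoint P Q)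
    (hs : ∀ x ∈ G.support P, x ∈ G.support Q → x = u ∨ x = v) : G.IsCircuit (P ∪ Q) := by
  obtain ⟨hne, hc, huv, hu, hv, hdu, hdv, hdP⟩ := hP
  obtain ⟨hne', hc', -, hu', hv', hdu', hdv', hdQ⟩ := hQ
  refine ⟨hne.mono Finset.subset_union_left, connOn_of_root u ?_, ?_⟩
  · intro x hx
    rw [support_union, Finset.mem_union] at hx
    rcases hx with hx | hx
    · exact (hc x hx u hu).mono Finset.subset_union_left
    · exact (hc' x hx u hu').mono Finset.subset_union_right
  · intro x hx
    rw [support_union, Finset.mem_union] at hx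
    rw [degIn_union hd]
    by_cases h1 : x = u
    · subst h1; rw [hdu, hdu']
    by_cases h2 : x = v
    · subst h2; rw [hdv, hdv']
    rcases hx with hx | hx
    · rw [hdP x hx h1 h2, degIn_eq_zero fun h => (hs x hx h).elim h1 h2]
    · rw [hdQ x hx h1 h2, degIn_eq_zero fun h => (hs x h hx).elim h1 h2]

/-- If `bd S` is the sum of two distinct vertices then `S` connects them. -/
theorem reach_of_bd {S : Finset G.E} {u v : G.V}
    (h : G.bd S = Pi.single u 1 + Pi.single v 1) : G.Reach S u v := by
  by_contra hr
  have h1 := sum_bd S (Finset.univ.filter fun w => G.Reach S u w)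
  rw [boundary_reach_eq_empty, h] at h1
  simp only [Pi.add_apply, Finset.sum_add_distrib, Finset.sum_pi_single', Finset.mem_filter,
    Finset.mem_univ, true_and, hr, if_false, Finset.card_empty] at h1
  rw [if_pos (show G.Reach S u u from .refl)] at h1
  simp at h1

/-- Every edge of an even edge set lies in a circuit of that set. -/
theorem exists_circuit {H : Finset G.E} (hH : G.bd H = 0) {e : G.E} (he : e ∈ H) :
    ∃ C ⊆ H, e ∈ C ∧ G.IsCircuit C := by
  obtain ⟨x, y, h⟩ := exists_ends e
  by_cases hxy : x = y
  · subst hxy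
    refine ⟨{e}, by simpa using he, by simp, by simp, connOn_of_root x ?_, ?_⟩
    all_goals
      intro u hu
      rw [support_singleton h] at hu
      simp only [Finset.mem_insert, Finset.mem_singleton, or_self] at hu
      subst hu
    · exact .refl
    · rw [degIn_singleton h]; simp
  · have hb : G.bd (H \ {e}) = Pi.single x 1 + Pi.single y 1 := by
      rw [bd_sdiff (by simpa using he), hH, zero_add, ← inc_eq h]
      exact Finset.sum_singleton _ _
    obtain ⟨P, hPH, hP⟩ := exists_path hxy (reach_of_bd hb)
    have heP : e ∉ P := fun h' => by simpa using hPH h'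
    refine ⟨{e} ∪ P, ?_, by simp, isCircuit_union_of_isPath (isPath_singleton h hxy) hP
      (by simpa using heP) ?_⟩
    · exact Finset.union_subset (by simpa using he) (hPH.trans Finset.sdiff_subset)
    · intro w hw _
      rw [support_singleton h] at hw
      simpa using hw

/-- A circuit contains no smaller nonempty even edge set. -/
theorem IsCircuit.eq_of_subset {C D : Finset G.E} (hC : G.IsCircuit C) (hDC : D ⊆ C)
    (hne : D.Nonempty) (hD : G.bd D = 0) : D = C := by
  have hdeg : ∀ x ∈ G.support D, G.degIn (C \ D) x = 0 := by
    intro x hx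
    have h1 := degIn_sdiff_add hDC x
    rw [hC.2.2 x (support_mono hDC hx)] at h1
    have h2 : Even (G.degIn D x) := by
      rw [← ZMod.natCast_eq_zero_iff_even, ← bd_apply, hD]; rfl
    have h3 := degIn_pos_iff.2 hx
    obtain ⟨k, hk⟩ := h2
    omega
  have hmem : ∀ e ∈ C, ∀ x ∈ G.ends e, x ∈ G.support D → e ∈ D := by
    intro e he x hxe hx
    by_contra heD
    have := degIn_pos_iff.2 (mem_support.2 ⟨e, Finset.mem_sdiff.2 ⟨he, heD⟩, hxe⟩)
    rw [hdeg x hx] at this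
    exact this.false
  obtain ⟨d, hd⟩ := hne
  obtain ⟨a, b, hab⟩ := exists_ends d
  have ha : a ∈ G.support D := mem_support.2 ⟨d, hd, by simp [hab]⟩
  refine Finset.Subset.antisymm hDC fun e he => ?_
  obtain ⟨x, y, h⟩ := exists_ends e
  have hr : G.Reach C a x :=
    hC.2.1 a (support_mono hDC ha) x (mem_support.2 ⟨e, he, by simp [h]⟩)
  have hreach : ∀ z, G.Reach C a z → z ∈ G.support D := by
    intro z hz
    induction hz with
    | refl => exact ha
    | tail _ hbc ih =>
      obtain ⟨f, hf, hf'⟩ := hbc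
      exact mem_support.2 ⟨f, hmem f hf _ (by rw [hf']; simp) ih, by simp [hf']⟩
  exact hmem e he x (by simp [h]) (hreach x hr)

theorem exists_circuit_decomposition (H : Finset G.E) (hH : G.bd H = 0) :
    ∃ 𝒰 : Finset (Finset G.E), (∀ C ∈ 𝒰, G.IsCircuit C) ∧
      (𝒰 : Set (Finset G.E)).PairwiseDisjoint id ∧ 𝒰.biUnion id = H := by
  induction H using Finset.strongInduction with
  | H H ih =>
    obtain rfl | ⟨e, he⟩ := H.eq_empty_or_nonempty
    · exact ⟨∅, by simp, by simp, by simp⟩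
    obtain ⟨C, hCH, heC, hC⟩ := exists_circuit hH he
    have hlt : H \ C ⊂ H := Finset.sdiff_ssubset hCH ⟨e, heC⟩
    obtain ⟨𝒰, h𝒰, hd, hun⟩ := ih _ hlt (by rw [bd_sdiff hCH, hH, hC.bd_eq, add_zero])
    refine ⟨insert C 𝒰, ?_, ?_, ?_⟩
    · simpa using ⟨hC, h𝒰⟩
    · rw [Finset.coe_insert]
      refine hd.insert fun D hD _ => ?_
      have : D ⊆ H \ C := hun ▸ Finset.subset_biUnion_of_mem id hD
      exact Finset.disjoint_of_subset_right this Finset.disjoint_sdiff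
    · rw [Finset.biUnion_insert, hun]
      exact Finset.union_sdiff_of_subset hCH

theorem card_negEdges_union {S T : Finset G.E} (h : Disjoint S T) :
    (G.negEdges (S ∪ T)).card = (G.negEdges S).card + (G.negEdges T).card := by
  rw [negEdges, Finset.filter_union, Finset.card_union_of_disjoint
    (Finset.disjoint_filter_filter h)]
  rfl

/-- Two edge-disjoint unbalanced circuits with two common vertices contain a balanced circuit. -/
theorem exists_balanced_circuit {C D : Finset G.E} (hC : G.IsUnbalancedCircuit C)
    (hD : G.IsUnbalancedCircuit D) (hCD : Disjoint C D)
    (h : 1 < (G.support C ∩ G.support D).card) : ∃ B ⊆ C ∪ D, G.IsBalancedCircuit B := by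
  obtain ⟨a, ha, b, hb, hab⟩ := Finset.one_lt_card.1 h
  rw [Finset.mem_inter] at ha hb
  obtain ⟨u, hu, v, hv, P, hPC, hP, -, hPD⟩ := exists_path_between (A := {a})
    (B := (G.support D).erase a) (by simp) (Finset.mem_singleton_self a)
    (Finset.mem_erase.2 ⟨hab.symm, hb.2⟩) (hC.1.2.1 a ha.1 b hb.1)
  rw [Finset.mem_singleton] at hu
  subst hu
  rw [Finset.mem_erase] at hv
  obtain ⟨Q, hQD, hQ⟩ := exists_path hv.1.symm (hD.1.2.1 u ha.2 v hv.2)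
  obtain ⟨Q', hQ'D, hQ'⟩ := exists_path hv.1.symm (S := D \ Q) (reach_of_bd (by
    rw [bd_sdiff hQD, hD.1.bd_eq, hQ.bd_eq, zero_add]))
  have hQQ' : Disjoint Q Q' := Finset.disjoint_of_subset_right hQ'D Finset.disjoint_sdiff
  replace hQ'D := hQ'D.trans Finset.sdiff_subset
  have hun : Q ∪ Q' = D := hD.1.eq_of_subset (Finset.union_subset hQD hQ'D)
    (hQ.1.mono Finset.subset_union_left) (by
      rw [bd_union hQQ', hQ.bd_eq, hQ'.bd_eq, add_self_zmod2])
  have hcirc : ∀ R ⊆ D, G.IsPath R u v → G.IsCircuit (P ∪ R) ∧ Disjoint P R := by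
    intro R hRD hR
    have hPR : Disjoint P R := Finset.disjoint_of_subset_left hPC
      (Finset.disjoint_of_subset_right hRD hCD)
    refine ⟨isCircuit_union_of_isPath hP hR hPR fun x hx hx' => ?_, hPR⟩
    by_cases hxu : x = u
    · exact .inl hxu
    · exact .inr (hPD x hx (Finset.mem_erase.2 ⟨hxu, support_mono hRD hx'⟩))
  obtain ⟨h1, hd1⟩ := hcirc Q hQD hQ
  obtain ⟨h2, hd2⟩ := hcirc Q' hQ'D hQ'
  have hodd := hD.2
  rw [← hun, card_negEdges_union hQQ'] at hodd
  by_cases hev : Even (G.negEdges (P ∪ Q)).card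
  · exact ⟨_, Finset.union_subset_union hPC hQD, h1, hev⟩
  · refine ⟨_, Finset.union_subset_union hPC hQ'D, h2, ?_⟩
    rw [card_negEdges_union hd1] at hev
    rw [card_negEdges_union hd2]
    grind

/-- Two unbalanced circuits joined by a connection in `J` extend to a barbell. -/
theorem exists_barbell {C D J : Finset G.E} (hC : G.IsUnbalancedCircuit C)
    (hD : G.IsUnbalancedCircuit D) (hCD : Disjoint C D)
    (h : (G.support C ∩ G.support D).card ≤ 1) {u v : G.V} (hu : u ∈ G.support C)
    (hv : v ∈ G.support D) (hr : G.Reach J u v) :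
    ∃ B, G.IsSignedCircuit B ∧ C ∪ D ⊆ B ∧ B.card ≤ C.card + D.card + J.card := by
  obtain h1 | h0 : (G.support C ∩ G.support D).card = 1 ∨
      (G.support C ∩ G.support D).card = 0 := by omega
  · refine ⟨C ∪ D, .inr (.inl ⟨C, D, hC, hD, hCD, h1, rfl⟩), subset_rfl, ?_⟩
    rw [Finset.card_union_of_disjoint hCD]
    omega
  · rw [Finset.card_eq_zero, ← Finset.disjoint_iff_inter_eq_empty] at h0
    obtain ⟨u', hu', v', hv', P, hPJ, hP, hPC, hPD⟩ := exists_path_between h0 hu hv hr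
    have hdisj : ∀ (X : Finset G.E) (w : G.V), G.degIn P w = 1 →
        (∀ x ∈ G.support P, x ∈ G.support X → x = w) → Disjoint P X := by
      intro X w hdw hX
      rw [Finset.disjoint_left]
      intro e heP heX
      obtain ⟨x, y, hxy⟩ := exists_ends e
      have key : ∀ z ∈ G.ends e, z = w := fun z hz =>
        hX z (mem_support.2 ⟨e, heP, hz⟩) (mem_support.2 ⟨e, heX, hz⟩)
      have h1 := degIn_sdiff_add (Finset.singleton_subset_iff.2 heP) w
      rw [degIn_singleton hxy, key x (by simp [hxy]), key y (by simp [hxy]), hdw] at h1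
      simp at h1
    have hsupp : ∀ (X : Finset G.E) (w : G.V), w ∈ G.support P → w ∈ G.support X →
        (∀ x ∈ G.support P, x ∈ G.support X → x = w) →
        G.support P ∩ G.support X = {w} := by
      intro X w hwP hwX hX
      ext x
      rw [Finset.mem_inter, Finset.mem_singleton]
      exact ⟨fun hx => hX x hx.1 hx.2, by rintro rfl; exact ⟨hwP, hwX⟩⟩
    obtain ⟨-, -, -, huP, hvP, hdu, hdv, -⟩ := id hP
    refine ⟨C ∪ D ∪ P, .inr (.inr ⟨C, D, P, u', v', hC, hD, h0, hP, hsupp C u' huP hu' hPC,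
      hsupp D v' hvP hv' hPD, hdisj C u' hdu hPC, hdisj D v' hdv hPD, rfl⟩),
      Finset.subset_union_left, ?_⟩
    have h1 := Finset.card_union_le (C ∪ D) P
    have h2 := Finset.card_union_le C D
    have h3 := Finset.card_le_card hPJ
    omega

theorem Reach.exists_bd_eq {J : Finset G.E} {u v : G.V} (h : G.Reach J u v) :
    ∃ P ⊆ J, G.bd P = Pi.single u 1 + Pi.single v 1 ∧ G.Reach P u v := by
  by_cases huv : u = v
  · subst huv
    exact ⟨∅, by simp, by rw [add_self_zmod2, bd_empty], .refl⟩
  · obtain ⟨P, hPJ, hP⟩ := exists_path huv h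
    exact ⟨P, hPJ, hP.bd_eq, reach_of_bd hP.bd_eq⟩

@[simp] theorem coverLength_zero : G.coverLength 0 = 0 := rfl

theorem coverLength_cons (S : Finset G.E) (F : Multiset (Finset G.E)) :
    G.coverLength (S ::ₘ F) = S.card + G.coverLength F := by
  simp [coverLength]

theorem coverLength_add (F F' : Multiset (Finset G.E)) :
    G.coverLength (F + F') = G.coverLength F + G.coverLength F' := by
  simp [coverLength]

/-- Unbalanced circuits which are nearly vertex-disjoint can be paired up into barbells along
a join of their representatives. -/
theorem exists_cover_of_bd_eq_sum (r : Finset G.E → G.V) (𝒰 : Finset (Finset G.E))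
    (h𝒰 : ∀ U ∈ 𝒰, G.IsUnbalancedCircuit U) (hd : (𝒰 : Set (Finset G.E)).PairwiseDisjoint id)
    (hs : ∀ U ∈ 𝒰, ∀ U' ∈ 𝒰, U ≠ U' → (G.support U ∩ G.support U').card ≤ 1)
    (hr : ∀ U ∈ 𝒰, r U ∈ G.support U) (J : Finset G.E)
    (hJ : G.bd J = ∑ U ∈ 𝒰, Pi.single (r U) 1) :
    ∃ F : Multiset (Finset G.E), (∀ S ∈ F, G.IsSignedCircuit S) ∧
      (∀ U ∈ 𝒰, ∀ e ∈ U, ∃ S ∈ F, e ∈ S) ∧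
      G.coverLength F ≤ ∑ U ∈ 𝒰, U.card + J.card := by
  induction 𝒰 using Finset.strongInduction generalizing J with
  | H 𝒰 ih =>
    obtain rfl | ⟨U, hU⟩ := 𝒰.eq_empty_or_nonempty
    · exact ⟨0, by simp, by simp, by simp⟩
    obtain ⟨U', hU', hUU', hreach⟩ : ∃ U' ∈ 𝒰, U' ≠ U ∧ G.Reach J (r U) (r U') := by
      have h1 := sum_bd J (Finset.univ.filter fun w => G.Reach J (r U) w)
      rw [boundary_reach_eq_empty, hJ] at h1
      simp only [Finset.sum_apply] at h1
      rw [Finset.sum_comm] at h1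
      simp only [Finset.sum_pi_single', Finset.mem_filter, Finset.mem_univ, true_and,
        Finset.sum_boole, Finset.card_empty, Nat.cast_zero] at h1
      rw [ZMod.natCast_eq_zero_iff_even] at h1
      have hUm : U ∈ 𝒰.filter fun U' => G.Reach J (r U) (r U') :=
        Finset.mem_filter.2 ⟨hU, .refl⟩
      have hpos := Finset.card_pos.2 ⟨U, hUm⟩
      obtain ⟨U', hU', hne⟩ := Finset.exists_mem_ne (s := 𝒰.filter fun U' =>
        G.Reach J (r U) (r U')) (by obtain ⟨k, hk⟩ := h1; omega) U
      rw [Finset.mem_filter] at hU'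
      exact ⟨U', hU'.1, hne, hU'.2⟩
    obtain ⟨P, hPJ, hbP, hrP⟩ := hreach.exists_bd_eq
    obtain ⟨B, hB, hUB, hBc⟩ := exists_barbell (h𝒰 U hU) (h𝒰 U' hU') (hd hU hU' hUU'.symm)
      (hs U hU U' hU' hUU'.symm) (hr U hU) (hr U' hU') hrP
    have hU'e : U' ∈ 𝒰.erase U := Finset.mem_erase.2 ⟨hUU', hU'⟩
    have hsub : (𝒰.erase U).erase U' ⊆ 𝒰 :=
      (Finset.erase_subset _ _).trans (Finset.erase_subset _ _)
    have hsum : ∀ {M : Type} [AddCommMonoid M] (f : Finset G.E → M),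
        ∑ X ∈ 𝒰, f X = f U + (f U' + ∑ X ∈ (𝒰.erase U).erase U', f X) := by
      intro M _ f
      rw [Finset.add_sum_erase _ f hU'e, Finset.add_sum_erase _ f hU]
    obtain ⟨F, hF, hcov, hlen⟩ := ih ((𝒰.erase U).erase U')
      ((Finset.erase_subset _ _).trans_ssubset (Finset.erase_ssubset hU))
      (fun X hX => h𝒰 X (hsub hX)) (hd.subset (Finset.coe_subset.2 hsub))
      (fun X hX X' hX' => hs X (hsub hX) X' (hsub hX')) (fun X hX => hr X (hsub hX)) (J \ P) (by
        rw [bd_sdiff hPJ, hJ, hbP, hsum, ← add_assoc (Pi.single (r U) 1), add_right_comm,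
          add_self_zmod2, zero_add])
    refine ⟨B ::ₘ F, ?_, ?_, ?_⟩
    · intro S hS
      rw [Multiset.mem_cons] at hS
      rcases hS with rfl | hS
      · exact hB
      · exact hF S hS
    · intro X hX e he
      by_cases h1 : X = U
      · subst h1
        exact ⟨B, Multiset.mem_cons_self _ _, hUB (Finset.mem_union_left _ he)⟩
      by_cases h2 : X = U'
      · subst h2
        exact ⟨B, Multiset.mem_cons_self _ _, hUB (Finset.mem_union_right _ he)⟩
      obtain ⟨S, hS, heS⟩ := hcov X (by simp [h1, h2, hX]) e he
      exact ⟨S, Multiset.mem_cons_of_mem hS, heS⟩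
    · rw [coverLength_cons, hsum]
      rw [Finset.card_sdiff_of_subset hPJ] at hlen
      have := Finset.card_le_card hPJ
      omega

/-- An even edge set with an even number of negative edges can be covered by signed circuits,
using every edge once, together with a join of a suitable set of terminals. -/
theorem exists_terminals [Nonempty G.V] (H : Finset G.E) (hH : G.bd H = 0) (hev : Even (G.negEdges H).card) :
    ∃ τ : G.V → ZMod 2, ∑ v, τ v = 0 ∧ ∀ J, G.bd J = τ →
      ∃ F : Multiset (Finset G.E), (∀ S ∈ F, G.IsSignedCircuit S) ∧
        (∀ e ∈ H, ∃ S ∈ F, e ∈ S) ∧ G.coverLength F ≤ H.card + J.card := by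
  induction H using Finset.strongInduction with
  | H H ih =>
    by_cases hbal : ∃ C ⊆ H, G.IsBalancedCircuit C
    · obtain ⟨C, hCH, hC⟩ := hbal
      have hcard := card_negEdges_union (Finset.disjoint_sdiff (s := C) (t := H))
      rw [Finset.union_sdiff_of_subset hCH] at hcard
      obtain ⟨τ, hτ, hJ⟩ := ih (H \ C) (Finset.sdiff_ssubset hCH hC.1.1)
        (by rw [bd_sdiff hCH, hH, hC.1.bd_eq, add_zero]) (by
          have := hC.2
          rw [hcard] at hev
          grind)
      refine ⟨τ, hτ, fun J hJτ => ?_⟩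
      obtain ⟨F, hF, hcov, hlen⟩ := hJ J hJτ
      refine ⟨C ::ₘ F, ?_, ?_, ?_⟩
      · intro S hS
        rw [Multiset.mem_cons] at hS
        rcases hS with rfl | hS
        · exact .inl hC
        · exact hF S hS
      · intro e he
        by_cases heC : e ∈ C
        · exact ⟨C, Multiset.mem_cons_self _ _, heC⟩
        · obtain ⟨S, hS, heS⟩ := hcov e (Finset.mem_sdiff.2 ⟨he, heC⟩)
          exact ⟨S, Multiset.mem_cons_of_mem hS, heS⟩
      · rw [coverLength_cons]
        rw [Finset.card_sdiff_of_subset hCH] at hlen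
        have := Finset.card_le_card hCH
        omega
    · obtain ⟨𝒰, h𝒰, hd, hun⟩ := exists_circuit_decomposition H hH
      have hsub : ∀ U ∈ 𝒰, U ⊆ H := fun U hU => hun ▸ Finset.subset_biUnion_of_mem id hU
      have hunb : ∀ U ∈ 𝒰, G.IsUnbalancedCircuit U := fun U hU =>
        ⟨h𝒰 U hU, fun h => hbal ⟨U, hsub U hU, h𝒰 U hU, h⟩⟩
      have hrex : ∀ U : Finset G.E, ∃ v, U ∈ 𝒰 → v ∈ G.support U := by
        intro U
        by_cases hU : U ∈ 𝒰
        · obtain ⟨e, he⟩ := (h𝒰 U hU).1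
          obtain ⟨x, y, h⟩ := exists_ends e
          exact ⟨x, fun _ => mem_support.2 ⟨e, he, by simp [h]⟩⟩
        · exact ⟨Classical.arbitrary _, fun h => absurd h hU⟩
      choose r hr using hrex
      refine ⟨∑ U ∈ 𝒰, Pi.single (r U) 1, ?_, fun J hJ => ?_⟩
      · simp only [Finset.sum_apply]
        rw [Finset.sum_comm]
        simp only [Finset.sum_pi_single', Finset.mem_univ, if_true]
        rw [← ZMod.natCast_eq_zero_iff_even, negEdges, ← hun, Finset.filter_biUnion,
          Finset.card_biUnion, Nat.cast_sum] at hev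
        · rw [← hev]
          refine Finset.sum_congr rfl fun U hU => ?_
          have := (hunb U hU).2
          rw [Nat.not_even_iff_odd, ← ZMod.natCast_eq_one_iff_odd] at this
          exact this.symm
        · exact fun U hU U' hU' hne => Finset.disjoint_filter_filter (hd hU hU' hne)
      · obtain ⟨F, hF, hcov, hlen⟩ := exists_cover_of_bd_eq_sum r 𝒰 hunb hd (by
          intro U hU U' hU' hne
          by_contra hlt
          obtain ⟨B, hB, hBb⟩ := exists_balanced_circuit (hunb U hU) (hunb U' hU')
            (hd hU hU' hne) (by omega)
          exact hbal ⟨B, hB.trans (Finset.union_subset (hsub U hU) (hsub U' hU')), hBb⟩)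
          (fun U hU => hr U hU) J hJ
        refine ⟨F, hF, fun e he => ?_, ?_⟩
        · rw [← hun, Finset.mem_biUnion] at he
          obtain ⟨U, hU, heU⟩ := he
          exact hcov U hU e heU
        · rwa [← hun, Finset.card_biUnion fun U hU U' hU' hne => hd hU hU' hne]

/-- **Rado's theorem** for three copies of a submodular function: a set on which three times `f`
dominates the cardinality is a union of three sets on which `f` equals the cardinality. -/
theorem exists_cover_of_submodular {α : Type*} (R : Finset α) (f : Finset α → ℤ)
    (hmono : ∀ S T, S ⊆ T → T ⊆ R → f S ≤ f T)
    (hsub : ∀ S T, S ⊆ R → T ⊆ R → f (S ∪ T) + f (S ∩ T) ≤ f S + f T)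
    (hle : ∀ S, S ⊆ R → f S ≤ S.card) (hR : ∀ S, S ⊆ R → (S.card : ℤ) ≤ 3 * f S) :
    ∃ I : Fin 3 → Finset α, (∀ e ∈ R, ∃ i, e ∈ I i) ∧ ∀ i, I i ⊆ R ∧ f (I i) = (I i).card := by
  let part : (α → Finset (Fin 3)) → Finset α → Fin 3 → Finset α :=
    fun A S i => S.filter fun s => i ∈ A s
  let Good : (α → Finset (Fin 3)) → Prop := fun A =>
    ∀ S ⊆ R, (S.card : ℤ) ≤ ∑ i, f (part A S i)
  have hex : ∃ n, ∃ A, Good A ∧ ∑ e ∈ R, (A e).card = n := by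
    refine ⟨_, fun _ => Finset.univ, fun S hS => ?_, rfl⟩
    have := hR S hS
    simpa [part] using this
  obtain ⟨A, hA, hAn⟩ := Nat.find_spec hex
  have hmin : ∀ A', Good A' → ∑ e ∈ R, (A e).card ≤ ∑ e ∈ R, (A' e).card := fun A' hA' =>
    hAn ▸ Nat.find_min' hex ⟨A', hA', rfl⟩
  have hpart : ∀ A S i, S ⊆ R → part A S i ⊆ R := fun A S i hS =>
    (Finset.filter_subset _ _).trans hS
  -- removing an index violates the condition on a set containing the element
  have hbad : ∀ e ∈ R, ∀ i ∈ A e, ∃ S ⊆ R, e ∈ S ∧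
      ∑ l, f (part (Function.update A e ((A e).erase i)) S l) < S.card := by
    intro e he i hi
    have hlt : ∑ x ∈ R, (Function.update A e ((A e).erase i) x).card < ∑ x ∈ R, (A x).card := by
      refine Finset.sum_lt_sum (fun x _ => ?_) ⟨e, he, ?_⟩
      · by_cases hx : x = e
        · subst hx; simpa using Finset.card_le_card (Finset.erase_subset _ _)
        · simp [hx]
      · simpa using Finset.card_erase_lt_of_mem hi
    have hng : ¬ Good (Function.update A e ((A e).erase i)) := fun h =>
      absurd (hmin _ h) (by omega)
    simp only [Good, not_forall, not_le] at hng
    obtain ⟨S, hS, hlt'⟩ := hng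
    refine ⟨S, hS, ?_, hlt'⟩
    by_contra heS
    have heq : ∀ l, part (Function.update A e ((A e).erase i)) S l = part A S l := fun l =>
      Finset.filter_congr fun x hx => by
        rw [Function.update_of_ne (by rintro rfl; exact heS hx)]
    simp only [heq] at hlt'
    exact absurd (hA S hS) (by omega)
  have hone : ∀ e ∈ R, (A e).card ≤ 1 := by
    intro e he
    by_contra hlt
    obtain ⟨i, hi, j, hj, hij⟩ := Finset.one_lt_card.1 (not_le.1 hlt)
    obtain ⟨S, hS, heS, h1⟩ := hbad e he i hi
    obtain ⟨T, hT, heT, h2⟩ := hbad e he j hj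
    have key : ∀ l, f (part A (S ∪ T) l) + f (part A ((S ∩ T).erase e) l) ≤
        f (part (Function.update A e ((A e).erase i)) S l) +
        f (part (Function.update A e ((A e).erase j)) T l) := by
      intro l
      refine le_trans (add_le_add ?_ ?_) (hsub _ _ (hpart _ _ _ hS) (hpart _ _ _ hT))
      · refine hmono _ _ ?_ (Finset.union_subset (hpart _ _ _ hS) (hpart _ _ _ hT))
        intro x hx
        simp only [part, Finset.mem_union, Finset.mem_filter] at hx ⊢
        by_cases hxe : x = e
        · subst hxe
          simp only [Function.update_self, Finset.mem_erase]
          by_cases hli : l = i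
          · exact .inr ⟨heT, by rw [hli]; exact hij, hx.2⟩
          · exact .inl ⟨heS, hli, hx.2⟩
        · simp only [Function.update_of_ne hxe]
          tauto
      · refine hmono _ _ ?_ (Finset.inter_subset_left.trans (hpart _ _ _ hS))
        intro x hx
        simp only [part, Finset.mem_inter, Finset.mem_filter, Finset.mem_erase] at hx ⊢
        simp only [Function.update_of_ne hx.1.1]
        tauto
    have hsum := Finset.sum_le_sum fun l (_ : l ∈ Finset.univ) => key l
    rw [Finset.sum_add_distrib, Finset.sum_add_distrib] at hsum
    have h3 := hA (S ∪ T) (Finset.union_subset hS hT)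
    have h4 := hA ((S ∩ T).erase e)
      ((Finset.erase_subset _ _).trans (Finset.inter_subset_left.trans hS))
    have h5 := Finset.card_union_add_card_inter S T
    have h6 := Finset.card_erase_add_one (Finset.mem_inter.2 ⟨heS, heT⟩)
    omega
  have hsum : ∑ i, (part A R i).card = ∑ e ∈ R, (A e).card := by
    simp only [part, Finset.card_filter]
    rw [Finset.sum_comm]
    simp
  have hcard : ∑ i, ((part A R i).card : ℤ) ≤ R.card := by
    rw [← Nat.cast_sum, hsum, Nat.cast_le]
    simpa using Finset.sum_le_sum hone
  refine ⟨part A R, fun e he => ?_, fun i => ⟨hpart _ _ _ subset_rfl, ?_⟩⟩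
  · by_contra hno
    have hemp : ∀ i, part A {e} i = ∅ := by
      intro i
      simp only [part, Finset.mem_filter, not_exists, not_and] at hno ⊢
      simpa using hno i he
    have h1 := hA {e} (by simpa using he)
    simp only [hemp] at h1
    have h2 := hle ∅ (by simp)
    simp at h1 h2
    omega
  · have h1 := hA R subset_rfl
    have h2 := fun l => hle (part A R l) (hpart A R l subset_rfl)
    refine le_antisymm (h2 i) ?_
    simp only [Fin.sum_univ_three] at h1 hcard
    have ha := h2 0
    have hb := h2 1
    have hc := h2 2
    fin_cases i <;> simp only [Fin.zero_eta, Fin.mk_one, Fin.reduceFinMk] <;> omega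

/-! ### Cut space rank -/

/-- The span over `ZMod 2` of the incidence vectors of the edges in `X`. -/
def cspan (G : SignedMultigraph) (X : Finset G.E) : Submodule (ZMod 2) (G.V → ZMod 2) :=
  Submodule.span (ZMod 2) (G.inc '' X)

/-- The rank of an edge set in the graphic matroid. -/
def rk (G : SignedMultigraph) (X : Finset G.E) : ℕ := Module.finrank (ZMod 2) (G.cspan X)

theorem cspan_mono {X Y : Finset G.E} (h : X ⊆ Y) : G.cspan X ≤ G.cspan Y :=
  Submodule.span_mono (Set.image_mono (Finset.coe_subset.2 h))

theorem rk_mono {X Y : Finset G.E} (h : X ⊆ Y) : G.rk X ≤ G.rk Y :=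
  Submodule.finrank_mono (cspan_mono h)

theorem cspan_union (X Y : Finset G.E) : G.cspan (X ∪ Y) = G.cspan X ⊔ G.cspan Y := by
  rw [cspan, Finset.coe_union, Set.image_union, Submodule.span_union]
  rfl

theorem rk_submodular (X Y : Finset G.E) :
    G.rk (X ∪ Y) + G.rk (X ∩ Y) ≤ G.rk X + G.rk Y := by
  rw [rk, rk, rk, rk, ← Submodule.finrank_sup_add_finrank_inf_eq (G.cspan X) (G.cspan Y),
    cspan_union]
  exact Nat.add_le_add_left (Submodule.finrank_mono (le_inf
    (cspan_mono Finset.inter_subset_left) (cspan_mono Finset.inter_subset_right))) _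

theorem rk_le_card (X : Finset G.E) : G.rk X ≤ X.card := by
  have h := finrank_span_finset_le_card (R := ZMod 2) (X.image G.inc)
  rw [Finset.coe_image] at h
  exact h.trans Finset.card_image_le

theorem inc_mem_cspan {X : Finset G.E} {e : G.E} (he : e ∈ X) : G.inc e ∈ G.cspan X :=
  Submodule.subset_span ⟨e, he, rfl⟩

theorem bd_mem_cspan {X D : Finset G.E} (h : D ⊆ X) : G.bd D ∈ G.cspan X :=
  Submodule.sum_mem _ fun _ he => inc_mem_cspan (h he)

theorem mem_cspan {X : Finset G.E} {x : G.V → ZMod 2} :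
    x ∈ G.cspan X ↔ ∃ D ⊆ X, G.bd D = x := by
  refine ⟨fun hx => ?_, by rintro ⟨D, hD, rfl⟩; exact bd_mem_cspan hD⟩
  induction hx using Submodule.span_induction with
  | mem x h =>
    obtain ⟨e, he, rfl⟩ := h
    exact ⟨{e}, by simpa using he, Finset.sum_singleton _ _⟩
  | zero => exact ⟨∅, by simp, by simp⟩
  | add x y _ _ hx hy =>
    obtain ⟨D, hD, rfl⟩ := hx
    obtain ⟨D', hD', rfl⟩ := hy
    refine ⟨symmDiff D D', ?_, bd_symmDiff D D'⟩
    exact Finset.union_subset (Finset.sdiff_subset.trans hD) (Finset.sdiff_subset.trans hD')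
  | smul a x _ hx =>
    obtain rfl | rfl : a = 0 ∨ a = 1 := by
      revert a; decide
    · exact ⟨∅, by simp, by simp⟩
    · rwa [one_smul]

theorem exists_basis {A X : Finset G.E} (hA : LinearIndepOn (ZMod 2) G.inc (A : Set G.E))
    (hAX : A ⊆ X) : ∃ T ⊆ X, A ⊆ T ∧ LinearIndepOn (ZMod 2) G.inc (T : Set G.E) ∧
      G.cspan T = G.cspan X ∧ T.card = G.rk X := by
  obtain ⟨b, hbX, hAb, hspan, hb⟩ := exists_linearIndepOn_extension hA (Finset.coe_subset.2 hAX)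
  have hfin : b.Finite := Set.toFinite b
  lift b to Finset G.E using hfin
  have hcs : G.cspan b = G.cspan X := le_antisymm (cspan_mono (by simpa using hbX))
    (Submodule.span_le.2 hspan)
  refine ⟨b, by simpa using hbX, by simpa using hAb, hb, hcs, ?_⟩
  rw [rk, ← hcs, cspan]
  have h := finrank_span_eq_card hb
  rw [Set.image_eq_range]
  simpa using h.symm

theorem Reach.single_add_single_mem {Q : Finset G.E} {u v : G.V} (h : G.Reach Q u v) :
    (Pi.single u 1 + Pi.single v 1 : G.V → ZMod 2) ∈ G.cspan Q := by
  obtain ⟨P, hP, hb, -⟩ := h.exists_bd_eq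
  exact hb ▸ bd_mem_cspan hP

/-- The vertex set of the component of `v`. -/
def comp (G : SignedMultigraph) (Q : Finset G.E) (v : G.V) : Finset G.V :=
  Finset.univ.filter fun w => G.Reach Q v w

/-- The vertex sets of the components. -/
def comps (G : SignedMultigraph) (Q : Finset G.E) : Finset (Finset G.V) :=
  Finset.univ.image (G.comp Q)

theorem mem_comp {Q : Finset G.E} {v w : G.V} : w ∈ G.comp Q v ↔ G.Reach Q v w := by
  simp [comp]

theorem Reach.comp_eq {Q : Finset G.E} {v w : G.V} (h : G.Reach Q v w) :
    G.comp Q v = G.comp Q w := by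
  ext z
  rw [mem_comp, mem_comp]
  exact ⟨h.symm.trans, h.trans⟩

theorem rk_le_rk_add_card_comps [Nonempty G.V] (P Q : Finset G.E) :
    G.rk P + 1 ≤ G.rk Q + (G.comps Q).card := by
  let v₀ : G.V := Classical.arbitrary _
  have hmem : ∀ v, G.comp Q v ∈ G.comps Q := fun v => Finset.mem_image_of_mem _ (Finset.mem_univ v)
  have hρ : ∀ K : Finset G.V, ∃ v, K.Nonempty → v ∈ K := fun K => by
    by_cases h : K.Nonempty
    · exact ⟨h.choose, fun _ => h.choose_spec⟩
    · exact ⟨v₀, fun h' => absurd h' h⟩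
  choose ρ hρ using hρ
  let s : Finset (G.V → ZMod 2) := ((G.comps Q).erase (G.comp Q v₀)).image fun K =>
    Pi.single (ρ K) 1 + Pi.single v₀ 1
  have hle : G.cspan P ≤ G.cspan Q ⊔ Submodule.span (ZMod 2) (s : Set (G.V → ZMod 2)) := by
    have key : ∀ v, (Pi.single v 1 + Pi.single v₀ 1 : G.V → ZMod 2) ∈
        G.cspan Q ⊔ Submodule.span (ZMod 2) (s : Set (G.V → ZMod 2)) := by
      intro v
      by_cases hv : G.Reach Q v v₀
      · exact Submodule.mem_sup_left hv.single_add_single_mem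
      · have hr : G.Reach Q v (ρ (G.comp Q v)) := mem_comp.1 (hρ _ ⟨v, mem_comp.2 .refl⟩)
        have h1 : (Pi.single (ρ (G.comp Q v)) 1 + Pi.single v₀ 1 : G.V → ZMod 2) ∈
            Submodule.span (ZMod 2) (s : Set (G.V → ZMod 2)) := by
          refine Submodule.subset_span (Finset.mem_coe.2 (Finset.mem_image.2
            ⟨G.comp Q v, Finset.mem_erase.2 ⟨fun h => hv ?_, hmem v⟩, rfl⟩))
          have : v₀ ∈ G.comp Q v := h ▸ mem_comp.2 .refl
          exact mem_comp.1 this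
        have h2 := Submodule.add_mem_sup hr.single_add_single_mem h1
        rwa [← add_assoc, add_assoc (Pi.single v 1), add_self_zmod2, add_zero] at h2
    refine Submodule.span_le.2 ?_
    rintro _ ⟨e, -, rfl⟩
    obtain ⟨x, y, h⟩ := exists_ends e
    rw [inc_eq h]
    have h2 := Submodule.add_mem _ (key x) (key y)
    rw [add_add_add_comm, add_self_zmod2, add_zero] at h2
    exact h2
  have h1 : G.rk P ≤ G.rk Q + s.card :=
    (Submodule.finrank_mono hle).trans ((Submodule.finrank_add_le_finrank_add_finrank _ _).trans
      (Nat.add_le_add_left (finrank_span_finset_le_card s) _))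
  have h2 : s.card ≤ ((G.comps Q).erase (G.comp Q v₀)).card := Finset.card_image_le
  have h3 := Finset.card_erase_add_one (hmem v₀)
  omega

theorem rk_lt_card_V [Nonempty G.V] (P : Finset G.E) : G.rk P + 1 ≤ Fintype.card G.V := by
  have h1 := rk_le_rk_add_card_comps P (∅ : Finset G.E)
  have h2 := rk_le_card (∅ : Finset G.E)
  have h3 : (G.comps ∅).card ≤ Fintype.card G.V := Finset.card_image_le
  simp at h2
  omega

theorem boundary_comp_subset {P S : Finset G.E} (v : G.V) :
    G.boundary P (G.comp (P \ S) v) ⊆ S := by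
  intro e he
  by_contra heS
  have h := boundary_reach_eq_empty (P \ S) v
  rw [boundary, Finset.filter_eq_empty_iff] at h
  rw [boundary, Finset.mem_filter] at he
  exact h (Finset.mem_sdiff.2 ⟨he.1, heS⟩) he.2

/-- Components of the complement of a set without small cuts are few. -/
theorem three_mul_rk_le [Nonempty G.V] {P R S : Finset G.E} (hSR : S ⊆ R)
    (hconn : ∀ U, G.boundary P U = ∅ → U = ∅ ∨ U = Finset.univ)
    (hR : ∀ U, G.boundary P U ⊆ R → (G.boundary P U).Nonempty → 3 ≤ (G.boundary P U).card) :
    3 * G.rk P ≤ 3 * G.rk (P \ S) + 2 * S.card := by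
  have hrk := rk_le_rk_add_card_comps P (P \ S)
  by_cases hc : (G.comps (P \ S)).card ≤ 1
  · omega
  have h3 : ∀ K ∈ G.comps (P \ S), 3 ≤ (S.filter fun e => G.crossesB K e = true).card := by
    intro K hK
    obtain ⟨v, -, rfl⟩ := Finset.mem_image.1 hK
    have hb := boundary_comp_subset (P := P) (S := S) v
    refine (hR _ (hb.trans hSR) ?_).trans (Finset.card_le_card fun e he =>
      Finset.mem_filter.2 ⟨hb he, (Finset.mem_filter.1 he).2⟩)
    rw [Finset.nonempty_iff_ne_empty]
    intro hemp
    rcases hconn _ hemp with h | h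
    · have : v ∈ G.comp (P \ S) v := mem_comp.2 .refl
      rw [h] at this
      simp at this
    · refine hc (Finset.card_le_one.2 fun K hK K' hK' => ?_)
      obtain ⟨w, -, rfl⟩ := Finset.mem_image.1 hK
      obtain ⟨w', -, rfl⟩ := Finset.mem_image.1 hK'
      have h1 : G.Reach (P \ S) v w := mem_comp.1 (h ▸ Finset.mem_univ w)
      have h2 : G.Reach (P \ S) v w' := mem_comp.1 (h ▸ Finset.mem_univ w')
      rw [← h1.comp_eq, ← h2.comp_eq]
  have h2 : ∀ e ∈ S, ((G.comps (P \ S)).filter fun K => G.crossesB K e = true).card ≤ 2 := by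
    intro e _
    obtain ⟨x, y, hxy⟩ := exists_ends e
    refine (Finset.card_le_card (t := {G.comp (P \ S) x, G.comp (P \ S) y}) ?_).trans
      Finset.card_le_two
    intro K hK
    rw [Finset.mem_filter, crossesB_eq_true hxy] at hK
    obtain ⟨v, -, rfl⟩ := Finset.mem_image.1 hK.1
    rw [Finset.mem_insert, Finset.mem_singleton]
    by_cases hx : x ∈ G.comp (P \ S) v
    · exact .inl (mem_comp.1 hx).comp_eq
    · have hy : y ∈ G.comp (P \ S) v := by by_contra hy; exact hK.2 (by simp [hx, hy])
      exact .inr (mem_comp.1 hy).comp_eq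
  have hle1 := Finset.card_nsmul_le_sum _ _ _ h3
  have hle2 := Finset.sum_le_card_nsmul _ _ _ h2
  have hswap : ∑ K ∈ G.comps (P \ S), (S.filter fun e => G.crossesB K e = true).card =
      ∑ e ∈ S, ((G.comps (P \ S)).filter fun K => G.crossesB K e = true).card := by
    simp only [Finset.card_filter]
    exact Finset.sum_comm
  simp only [smul_eq_mul] at hle1 hle2
  omega

/-- A set of edges containing no small cut is covered by three complements of bases. -/
theorem exists_three_cobases [Nonempty G.V] {P R : Finset G.E}
    (hconn : ∀ U, G.boundary P U = ∅ → U = ∅ ∨ U = Finset.univ)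
    (hR : ∀ U, G.boundary P U ⊆ R → (G.boundary P U).Nonempty → 3 ≤ (G.boundary P U).card) :
    ∃ I : Fin 3 → Finset G.E, (∀ e ∈ R, ∃ i, e ∈ I i) ∧
      ∀ i, I i ⊆ R ∧ G.cspan (P \ I i) = G.cspan P := by
  have hmono : ∀ S T, S ⊆ T → T ⊆ R → (S.card : ℤ) - G.rk P + G.rk (P \ S) ≤
      (T.card : ℤ) - G.rk P + G.rk (P \ T) := by
    intro S T hST hTR
    have h1 : P \ S ⊆ (P \ T) ∪ (T \ S) := by
      intro e
      simp only [Finset.mem_sdiff, Finset.mem_union]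
      tauto
    have h2 := rk_mono h1
    have h3 := rk_submodular (P \ T) (T \ S)
    have h4 := rk_le_card (T \ S)
    have h5 := Finset.card_sdiff_add_card_eq_card hST
    omega
  have hsub : ∀ S T, S ⊆ R → T ⊆ R →
      (((S ∪ T).card : ℤ) - G.rk P + G.rk (P \ (S ∪ T))) +
        (((S ∩ T).card : ℤ) - G.rk P + G.rk (P \ (S ∩ T))) ≤
      ((S.card : ℤ) - G.rk P + G.rk (P \ S)) + ((T.card : ℤ) - G.rk P + G.rk (P \ T)) := by
    intro S T hS hT
    have h1 := rk_submodular (P \ S) (P \ T)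
    have h2 := Finset.card_union_add_card_inter S T
    rw [← Finset.sdiff_inter_distrib_right, ← Finset.sdiff_union_distrib] at h1
    omega
  have hle : ∀ S, S ⊆ R → (S.card : ℤ) - G.rk P + G.rk (P \ S) ≤ S.card := by
    intro S hS
    have := rk_mono (Finset.sdiff_subset : P \ S ⊆ P)
    omega
  have hcard : ∀ S, S ⊆ R → (S.card : ℤ) ≤ 3 * ((S.card : ℤ) - G.rk P + G.rk (P \ S)) := by
    intro S hS
    have := three_mul_rk_le hS hconn hR
    omega
  obtain ⟨I, hI, hI'⟩ := exists_cover_of_submodular R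
    (fun S => (S.card : ℤ) - G.rk P + G.rk (P \ S)) hmono hsub hle hcard
  refine ⟨I, hI, fun i => ⟨(hI' i).1, Submodule.eq_of_le_of_finrank_eq
    (cspan_mono Finset.sdiff_subset) ?_⟩⟩
  have := (hI' i).2
  simp only [rk] at this
  omega

theorem reach_of_boundary {P : Finset G.E}
    (hconn : ∀ U, G.boundary P U = ∅ → U = ∅ ∨ U = Finset.univ) (u v : G.V) : G.Reach P u v := by
  rcases hconn _ (boundary_reach_eq_empty P u) with h | h
  · have : u ∈ G.comp P u := mem_comp.2 .refl
    rw [comp, h] at this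
    simp at this
  · exact mem_comp.1 (by rw [comp, h]; simp)

theorem mem_cspan_of_sum_eq_zero [Nonempty G.V] {P : Finset G.E}
    (hconn : ∀ U, G.boundary P U = ∅ → U = ∅ ∨ U = Finset.univ) {τ : G.V → ZMod 2}
    (hτ : ∑ v, τ v = 0) : τ ∈ G.cspan P := by
  let v₀ : G.V := Classical.arbitrary _
  have h : τ = ∑ v, τ v • (Pi.single v 1 + Pi.single v₀ 1 : G.V → ZMod 2) := by
    simp only [smul_add, Finset.sum_add_distrib]
    rw [← Finset.sum_smul, hτ, zero_smul, add_zero]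
    funext w
    simp [Finset.sum_apply, Pi.single_apply]
  rw [h]
  exact Submodule.sum_mem _ fun v _ => Submodule.smul_mem _ _
    (reach_of_boundary hconn v v₀).single_add_single_mem

theorem sum_bd_univ (S : Finset G.E) : ∑ v, G.bd S v = 0 := by
  rw [sum_bd]
  have : G.boundary S Finset.univ = ∅ := by
    rw [boundary, Finset.filter_eq_empty_iff]
    intro e _
    obtain ⟨x, y, h⟩ := exists_ends e
    rw [crossesB_eq_true h]
    simp
  simp [this]

theorem card_eq_sum_ite {α : Type*} {S P : Finset α} (h : S ⊆ P) :
    S.card = ∑ e ∈ P, if e ∈ S then 1 else 0 := by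
  rw [Finset.sum_boole, Finset.filter_mem_eq_inter, Finset.inter_eq_right.2 h, Nat.cast_id]

theorem symmDiff_subset {α : Type*} {S T P : Finset α} (hS : S ⊆ P) (hT : T ⊆ P) :
    symmDiff S T ⊆ P := symmDiff_le_sup.trans (sup_le hS hT)

theorem card_symmDiff_add_le {α : Type*} {P Z A B : Finset α} (hZ : Z ⊆ P) (hA : A ⊆ P)
    (hB : B ⊆ P) :
    Z.card + (symmDiff Z A).card + (symmDiff Z B).card + (symmDiff (symmDiff Z A) B).card +
      2 * (A ∪ B).card ≤ 4 * P.card := by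
  have hZA := symmDiff_subset hZ hA
  rw [card_eq_sum_ite hZ, card_eq_sum_ite hZA, card_eq_sum_ite (symmDiff_subset hZ hB),
    card_eq_sum_ite (symmDiff_subset hZA hB), card_eq_sum_ite (Finset.union_subset hA hB),
    ← Finset.sum_add_distrib, ← Finset.sum_add_distrib, ← Finset.sum_add_distrib, Finset.mul_sum,
    ← Finset.sum_add_distrib, mul_comm, ← smul_eq_mul]
  refine Finset.sum_le_card_nsmul _ _ _ fun e _ => ?_
  by_cases h1 : e ∈ Z <;> by_cases h2 : e ∈ A <;> by_cases h3 : e ∈ B <;>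
    simp [Finset.mem_symmDiff, h1, h2, h3]

theorem card_add_card_symmDiff {α : Type*} (A B : Finset α) :
    A.card + B.card + (symmDiff A B).card = 2 * (A ∪ B).card := by
  have hA : A ⊆ A ∪ B := Finset.subset_union_left
  have hB : B ⊆ A ∪ B := Finset.subset_union_right
  rw [card_eq_sum_ite hA, card_eq_sum_ite hB, card_eq_sum_ite (symmDiff_subset hA hB),
    ← Finset.sum_add_distrib, ← Finset.sum_add_distrib, mul_comm, ← smul_eq_mul]
  refine Finset.sum_eq_card_nsmul fun e he => ?_
  rw [Finset.mem_union] at he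
  by_cases h1 : e ∈ A <;> by_cases h2 : e ∈ B <;>
    simp [Finset.mem_symmDiff, h1, h2] at he ⊢

theorem bd_symmDiff_eq_zero {S T : Finset G.E} (hS : G.bd S = 0) (hT : G.bd T = 0) :
    G.bd (symmDiff S T) = 0 := by
  rw [bd_symmDiff, hS, hT, add_zero]

/-- Three even sets can be replaced by three even sets with the same union of small total size. -/
theorem exists_short_even_triple {P Z A B : Finset G.E} (hZ : Z ⊆ P) (hA : A ⊆ P) (hB : B ⊆ P)
    (hbZ : G.bd Z = 0) (hbA : G.bd A = 0) (hbB : G.bd B = 0) :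
    ∃ X Y W, X ⊆ P ∧ Y ⊆ P ∧ W ⊆ P ∧ G.bd X = 0 ∧ G.bd Y = 0 ∧ G.bd W = 0 ∧
      Z ∪ A ∪ B ⊆ X ∪ Y ∪ W ∧ 6 * (X.card + Y.card + W.card) ≤ 11 * P.card ∧
      8 * (X.card + Y.card + W.card) ≤ 8 * P.card + 5 * (A.card + B.card) := by
  obtain ⟨X, hXP, hbX, hXc, hXcov⟩ : ∃ X ⊆ P, G.bd X = 0 ∧
      2 * X.card + (A ∪ B).card ≤ 2 * P.card ∧ Z \ (A ∪ B) ⊆ X := by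
    have h := card_symmDiff_add_le hZ hA hB
    by_cases h1 : 2 * Z.card + (A ∪ B).card ≤ 2 * P.card
    · exact ⟨Z, hZ, hbZ, h1, Finset.sdiff_subset⟩
    by_cases h2 : 2 * (symmDiff Z A).card + (A ∪ B).card ≤ 2 * P.card
    · exact ⟨_, symmDiff_subset hZ hA, bd_symmDiff_eq_zero hbZ hbA, h2, fun e => by
        simp only [Finset.mem_symmDiff, Finset.mem_sdiff, Finset.mem_union]; tauto⟩
    by_cases h3 : 2 * (symmDiff Z B).card + (A ∪ B).card ≤ 2 * P.card
    · exact ⟨_, symmDiff_subset hZ hB, bd_symmDiff_eq_zero hbZ hbB, h3, fun e => by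
        simp only [Finset.mem_symmDiff, Finset.mem_sdiff, Finset.mem_union]; tauto⟩
    · exact ⟨_, symmDiff_subset (symmDiff_subset hZ hA) hB,
        bd_symmDiff_eq_zero (bd_symmDiff_eq_zero hbZ hbA) hbB, by omega, fun e => by
        simp only [Finset.mem_symmDiff, Finset.mem_sdiff, Finset.mem_union]; tauto⟩
  obtain ⟨Y, W, hYP, hWP, hbY, hbW, hYW1, hYW2, hcov⟩ : ∃ Y W, Y ⊆ P ∧ W ⊆ P ∧ G.bd Y = 0 ∧
      G.bd W = 0 ∧ Y.card + W.card ≤ A.card + B.card ∧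
      3 * (Y.card + W.card) ≤ 4 * (A ∪ B).card ∧ A ∪ B ⊆ Y ∪ W := by
    have h := card_add_card_symmDiff A B
    by_cases h1 : 3 * (A.card + B.card) ≤ 4 * (A ∪ B).card
    · exact ⟨A, B, hA, hB, hbA, hbB, le_rfl, h1, subset_rfl⟩
    have hAB := symmDiff_subset hA hB
    have hbAB := bd_symmDiff_eq_zero hbA hbB
    by_cases h2 : A.card ≤ B.card
    · exact ⟨A, symmDiff A B, hA, hAB, hbA, hbAB, by omega, by omega, fun e => by
        simp only [Finset.mem_symmDiff, Finset.mem_union]; tauto⟩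
    · exact ⟨B, symmDiff A B, hB, hAB, hbB, hbAB, by omega, by omega, fun e => by
        simp only [Finset.mem_symmDiff, Finset.mem_union]; tauto⟩
  have hAB := Finset.card_le_card (Finset.union_subset hA hB)
  refine ⟨X, Y, W, hXP, hYP, hWP, hbX, hbY, hbW, ?_, by omega, by omega⟩
  intro e he
  by_cases heAB : e ∈ A ∪ B
  · have := hcov heAB
    simp only [Finset.mem_union] at this ⊢
    tauto
  · have : e ∈ X := hXcov (by simp only [Finset.mem_union, Finset.mem_sdiff] at he heAB ⊢; tauto)
    simp [this]

theorem exists_even_completion {P T X : Finset G.E} (hT : G.cspan T = G.cspan P) (hX : X ⊆ P)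
    (hTP : T ⊆ P) (hXT : Disjoint X T) :
    ∃ C ⊆ P, G.bd C = 0 ∧ X ⊆ C ∧ C.card ≤ X.card + T.card := by
  have h := bd_mem_cspan hX
  rw [← hT, mem_cspan] at h
  obtain ⟨D, hD, hb⟩ := h
  refine ⟨X ∪ D, Finset.union_subset hX (hD.trans hTP), ?_, Finset.subset_union_left,
    (Finset.card_union_le _ _).trans (Nat.add_le_add_left (Finset.card_le_card hD) _)⟩
  rw [bd_union (Finset.disjoint_of_subset_right hD hXT), hb, add_self_zmod2]

/-- An independent set `K` containing all bridges of `P` has a complement in `P` covered by three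
even sets of small total size. -/
theorem exists_even_cover [Nonempty G.V] {P K : Finset G.E}
    (hconn : ∀ U, G.boundary P U = ∅ → U = ∅ ∨ U = Finset.univ) (hKP : K ⊆ P)
    (hK : LinearIndepOn (ZMod 2) G.inc (K : Set G.E))
    (hbridge : ∀ U e, G.boundary P U = {e} → e ∈ K) :
    ∃ X Y W, X ⊆ P ∧ Y ⊆ P ∧ W ⊆ P ∧ G.bd X = 0 ∧ G.bd Y = 0 ∧ G.bd W = 0 ∧
      P \ K ⊆ X ∪ Y ∪ W ∧ 6 * (X.card + Y.card + W.card) ≤ 11 * P.card ∧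
      8 * (X.card + Y.card + W.card) + 5 * K.card ≤ 8 * P.card + 15 * G.rk P := by
  let Good : Finset G.E → Prop := fun R =>
    ∀ U, G.boundary P U ⊆ R → (G.boundary P U).Nonempty → 3 ≤ (G.boundary P U).card
  obtain ⟨R, hRm⟩ := ((P \ K).powerset.filter Good).exists_maximal ⟨∅, by
    refine Finset.mem_filter.2 ⟨by simp, fun U hU hne => ?_⟩
    rw [Finset.subset_empty] at hU
    simp [hU] at hne⟩
  have hR := hRm.prop
  rw [Finset.mem_filter, Finset.mem_powerset] at hR
  obtain ⟨hRPK, hRgood⟩ := hR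
  have hRP : R ⊆ P := hRPK.trans Finset.sdiff_subset
  obtain ⟨I, hI, hI'⟩ := exists_three_cobases hconn hRgood
  have hbasis : ∀ i A, A ⊆ P → Disjoint A R → LinearIndepOn (ZMod 2) G.inc (A : Set G.E) →
      ∃ T ⊆ P, Disjoint T (I i) ∧ A ⊆ T ∧ G.cspan T = G.cspan P ∧ T.card = G.rk P := by
    intro i A hAP hAR hA
    obtain ⟨T, hTX, hAT, -, hTs, hTc⟩ := exists_basis (X := P \ I i) hA fun e he =>
      Finset.mem_sdiff.2 ⟨hAP he, fun h => Finset.disjoint_left.1 hAR he ((hI' i).1 h)⟩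
    refine ⟨T, hTX.trans Finset.sdiff_subset, Finset.disjoint_of_subset_left hTX
      Finset.sdiff_disjoint, hAT, hTs.trans (hI' i).2, ?_⟩
    rw [hTc, rk, (hI' i).2, rk]
  have hKR : Disjoint K R := Finset.disjoint_of_subset_right hRPK Finset.disjoint_sdiff
  have hemp : LinearIndepOn (ZMod 2) G.inc ((∅ : Finset G.E) : Set G.E) := by simp
  obtain ⟨T₁, hT₁P, hT₁I, hKT, hT₁s, hT₁c⟩ := hbasis 0 K hKP hKR hK
  obtain ⟨T₂, hT₂P, hT₂I, -, hT₂s, hT₂c⟩ := hbasis 1 ∅ (by simp) (by simp) hemp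
  obtain ⟨T₃, hT₃P, hT₃I, -, hT₃s, hT₃c⟩ := hbasis 2 ∅ (by simp) (by simp) hemp
  have hT₁₂₃ : ∀ e ∈ R, e ∈ T₁ → e ∈ T₂ → e ∈ T₃ → False := by
    intro e he h1 h2 h3
    obtain ⟨i, hi⟩ := hI e he
    fin_cases i
    · exact Finset.disjoint_left.1 hT₁I h1 hi
    · exact Finset.disjoint_left.1 hT₂I h2 hi
    · exact Finset.disjoint_left.1 hT₃I h3 hi
  obtain ⟨Z, hZP, hbZ, hZ, -⟩ := exists_even_completion (X := P \ T₁) hT₁s Finset.sdiff_subset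
    hT₁P Finset.sdiff_disjoint
  obtain ⟨A, hAP, hbA, hA, hAc⟩ := exists_even_completion (X := (R ∩ T₁) \ T₂) hT₂s
    (Finset.sdiff_subset.trans (Finset.inter_subset_left.trans hRP)) hT₂P Finset.sdiff_disjoint
  obtain ⟨B, hBP, hbB, hB, hBc⟩ := exists_even_completion (X := (R ∩ T₁) ∩ T₂) hT₃s
    (Finset.inter_subset_left.trans (Finset.inter_subset_left.trans hRP)) hT₃P
    (Finset.disjoint_left.2 fun e he h3 => by
      simp only [Finset.mem_inter] at he
      exact hT₁₂₃ e he.1.1 he.1.2 he.2 h3)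
  have hcovR : ∀ e ∈ R, e ∈ Z ∪ A ∪ B := by
    intro e he
    simp only [Finset.mem_union]
    by_cases h1 : e ∈ T₁
    · by_cases h2 : e ∈ T₂
      · exact .inr (hB (by simp [he, h1, h2]))
      · exact .inl (.inr (hA (by simp [he, h1, h2])))
    · exact .inl (.inl (hZ (by simp [hRP he, h1])))
  have hcov : P \ K ⊆ Z ∪ A ∪ B := by
    intro e he
    by_cases heR : e ∈ R
    · exact hcovR e heR
    have hng : ¬ Good (insert e R) := by
      intro hg
      have := hRm.le_of_ge (Finset.mem_filter.2 ⟨Finset.mem_powerset.2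
        (Finset.insert_subset he hRPK), hg⟩) (Finset.subset_insert e R)
      exact heR (this (Finset.mem_insert_self e R))
    simp only [Good, not_forall, not_le] at hng
    obtain ⟨U, hU, hUne, hUc⟩ := hng
    have heU : e ∈ G.boundary P U := by
      by_contra heU
      exact absurd (hRgood U ((Finset.subset_insert_iff_of_notMem heU).1 hU) hUne) (by omega)
    rw [Finset.mem_sdiff] at he
    have hc : (G.boundary P U).card = 2 := by
      have := Finset.card_pos.2 hUne
      by_contra hc
      obtain ⟨f, hf⟩ := Finset.card_eq_one.1 (show (G.boundary P U).card = 1 by omega)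
      rw [hf, Finset.mem_singleton] at heU
      subst heU
      exact he.2 (hbridge U e hf)
    obtain ⟨r, hr, hre⟩ := Finset.exists_mem_ne (s := G.boundary P U) (by omega) e
    have hUeq : G.boundary P U = {e, r} := by
      refine (Finset.eq_of_subset_of_card_le ?_ ?_).symm
      · simp [Finset.insert_subset_iff, heU, hr]
      · rw [hc, Finset.card_pair hre.symm]
    have hrR : r ∈ R := Finset.mem_of_mem_insert_of_ne (hU hr) hre
    have htrans : ∀ C ⊆ P, G.bd C = 0 → r ∈ C → e ∈ C := by
      intro C hCP hbC hrC
      by_contra heC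
      have hb : G.boundary C U = {r} := by
        ext f
        have := Finset.ext_iff.1 hUeq f
        simp only [boundary, Finset.mem_filter, Finset.mem_insert, Finset.mem_singleton] at this ⊢
        constructor
        · rintro ⟨hf, hf'⟩
          rcases this.1 ⟨hCP hf, hf'⟩ with rfl | h
          · exact absurd hf heC
          · exact h
        · rintro rfl
          exact ⟨hrC, (this.2 (.inr rfl)).2⟩
      have := even_boundary hbC U
      rw [hb] at this
      simp at this
    have := hcovR r hrR
    simp only [Finset.mem_union] at this ⊢
    exact this.imp (Or.imp (htrans Z hZP hbZ) (htrans A hAP hbA)) (htrans B hBP hbB)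
  obtain ⟨X, Y, W, hX, hY, hW, hbX, hbY, hbW, hcov', h1, h2⟩ :=
    exists_short_even_triple hZP hAP hBP hbZ hbA hbB
  refine ⟨X, Y, W, hX, hY, hW, hbX, hbY, hbW, hcov.trans hcov', h1, ?_⟩
  have h3 : ((R ∩ T₁) \ T₂).card + ((R ∩ T₁) ∩ T₂).card = (R ∩ T₁).card :=
    Finset.card_sdiff_add_card_inter _ _
  have h4 : (R ∩ T₁).card + K.card ≤ T₁.card := by
    rw [← Finset.card_union_of_disjoint (Finset.disjoint_of_subset_left Finset.inter_subset_left
      hKR.symm)]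
    exact Finset.card_le_card (Finset.union_subset Finset.inter_subset_right hKT)
  omega

/-! ### Switching -/

theorem natCast_card_filter_negAfter {C : Finset G.E} (hC : G.bd C = 0) (A : Finset G.V) :
    ((C.filter fun e => G.negAfter A e = true).card : ZMod 2) = (G.negEdges C).card := by
  have h1 : ((G.boundary C A).card : ZMod 2) = 0 :=
    (ZMod.natCast_eq_zero_iff_even).2 (even_boundary hC A)
  rw [← add_zero ((G.negEdges C).card : ZMod 2), ← h1, negEdges, boundary,
    Finset.natCast_card_filter, Finset.natCast_card_filter, Finset.natCast_card_filter,
    ← Finset.sum_add_distrib]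
  refine Finset.sum_congr rfl fun e _ => ?_
  rw [negAfter]
  cases G.neg e <;> cases G.crossesB A e <;> (simp; try rfl)

theorem crossesB_symmDiff (A U : Finset G.V) (e : G.E) :
    G.crossesB (symmDiff A U) e = (G.crossesB A e ^^ G.crossesB U e) := by
  obtain ⟨x, y, h⟩ := exists_ends e
  simp only [crossesB, h, Sym2.lift_mk, Finset.mem_symmDiff]
  by_cases h1 : x ∈ A <;> by_cases h2 : y ∈ A <;> by_cases h3 : x ∈ U <;>
    by_cases h4 : y ∈ U <;> simp [h1, h2, h3, h4]

/-- The positive edges of a minimum switching. -/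
theorem exists_positive_edges (G : SignedMultigraph) :
    ∃ P : Finset G.E, P.card + G.negativeness = Fintype.card G.E ∧
      (∀ U, (G.boundary Finset.univ U).card ≤ 2 * (G.boundary P U).card) ∧
      ∀ C, G.bd C = 0 → ((C \ P).card : ZMod 2) = (G.negEdges C).card := by
  have hne : { n | ∃ A : Finset G.V,
      (Finset.univ.filter fun e => G.negAfter A e = true).card = n }.Nonempty := ⟨_, ∅, rfl⟩
  obtain ⟨A, hA⟩ := Nat.sInf_mem hne
  have hmin : ∀ A' : Finset G.V, G.negativeness ≤
      (Finset.univ.filter fun e => G.negAfter A' e = true).card :=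
    fun A' => Nat.sInf_le ⟨A', rfl⟩
  replace hA : (Finset.univ.filter fun e => G.negAfter A e = true).card = G.negativeness := hA
  refine ⟨Finset.univ.filter fun e => ¬ G.negAfter A e = true, ?_, fun U => ?_, fun C hC => ?_⟩
  · rw [← hA, add_comm, Finset.card_filter_add_card_filter_not, Finset.card_univ]
  · have h := hmin (symmDiff A U)
    rw [← hA] at h
    have key : (Finset.univ.filter fun e => G.negAfter (symmDiff A U) e = true).card +
        (G.boundary Finset.univ U).card =
        (Finset.univ.filter fun e => G.negAfter A e = true).card +
        2 * (G.boundary (Finset.univ.filter fun e => ¬ G.negAfter A e = true) U).card := by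
      simp only [boundary, Finset.filter_filter, Finset.card_filter, Finset.mul_sum]
      rw [← Finset.sum_add_distrib, ← Finset.sum_add_distrib]
      refine Finset.sum_congr rfl fun e _ => ?_
      simp only [negAfter, crossesB_symmDiff]
      by_cases h1 : G.neg e = true <;> by_cases h2 : G.crossesB A e = true <;>
        by_cases h3 : G.crossesB U e = true <;> simp [h1, h2, h3]
    omega
  · rw [← natCast_card_filter_negAfter hC A]
    congr 2
    ext e
    simp

/-- An even set all of whose circuits are balanced is covered by its circuits. -/
theorem exists_balanced_cover {X : Finset G.E} (hX : G.bd X = 0)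
    (hbal : ∀ C ⊆ X, G.IsCircuit C → Even (G.negEdges C).card) :
    ∃ F : Multiset (Finset G.E), (∀ S ∈ F, G.IsSignedCircuit S) ∧
      (∀ e ∈ X, ∃ S ∈ F, e ∈ S) ∧ G.coverLength F ≤ X.card := by
  obtain ⟨𝒰, h𝒰, hd, hun⟩ := exists_circuit_decomposition X hX
  refine ⟨𝒰.val, fun C hC => .inl ⟨h𝒰 C hC, hbal C ?_ (h𝒰 C hC)⟩, fun e he => ?_, ?_⟩
  · exact hun ▸ Finset.subset_biUnion_of_mem id hC
  · rw [← hun, Finset.mem_biUnion] at he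
    exact he
  · rw [← hun, Finset.card_biUnion fun U hU U' hU' hne => hd hU hU' hne]
    exact le_rfl

theorem SCC_le {F : Multiset (Finset G.E)} (hF : ∀ S ∈ F, G.IsSignedCircuit S)
    (hcov : ∀ e, ∃ S ∈ F, e ∈ S) : G.SCC ≤ G.coverLength F := by
  refine Nat.sInf_le ⟨F, ⟨hF, fun e => ?_⟩, rfl⟩
  obtain ⟨S, hS, he⟩ := hcov e
  exact Multiset.card_pos_iff_exists_mem.2 ⟨S, Multiset.mem_filter.2 ⟨hS, he⟩⟩

theorem Connected.eq_empty_or_univ (h : G.Connected) {U : Finset G.V}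
    (hU : G.boundary Finset.univ U = ∅) : U = ∅ ∨ U = Finset.univ := by
  rw [or_iff_not_imp_left, ← ne_eq, ← Finset.nonempty_iff_ne_empty]
  rintro ⟨u, hu⟩
  refine Finset.eq_univ_of_forall fun v => ?_
  induction h.2 u v with
  | refl => exact hu
  | tail _ hbc ih =>
    obtain ⟨e, -, he⟩ := hbc
    rw [boundary, Finset.filter_eq_empty_iff] at hU
    have := hU (Finset.mem_univ e)
    rw [crossesB_eq_true he, not_not] at this
    exact this.1 ih

/-- The cover of a 2-edge-connected signed graph of even negativeness, with the sizes
of its parts: `k` is the rank of the positive subgraph of a minimum switching, `p` its size, `q`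
the total length of three even sets, `h` the size of a join and `j` that of the connections. -/
theorem exists_SCC_le (h2ec : G.TwoEdgeConnected) (heven : Even G.negativeness) :
    ∃ p k q h j : ℕ, p + G.negativeness = Fintype.card G.E ∧ k + 1 ≤ Fintype.card G.V ∧ k ≤ p ∧
      h ≤ k ∧ j ≤ k ∧ 2 * j + h ≤ 2 * k + G.negativeness ∧ 6 * q ≤ 11 * p ∧
      8 * q + 5 * h ≤ 8 * p + 15 * k ∧ G.SCC ≤ q + (h + G.negativeness) + j := by
  obtain ⟨hG, hbr⟩ := h2ec
  have : Nonempty G.V := hG.1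
  obtain ⟨P, hPc, hPcut, hPpar⟩ := G.exists_positive_edges
  have hconn : ∀ U, G.boundary P U = ∅ → U = ∅ ∨ U = Finset.univ := fun U hU =>
    hG.eq_empty_or_univ (Finset.card_eq_zero.1 (by
      have := hPcut U
      rw [hU] at this
      simpa using this))
  have hNc : (Pᶜ).card = G.negativeness := by
    have := Finset.card_add_card_compl P
    omega
  obtain ⟨T, hTP, -, hTi, hTs, hTc⟩ := exists_basis (G := G) (A := ∅) (X := P) (by simp) (by simp)
  have hspan : ∀ τ : G.V → ZMod 2, ∑ v, τ v = 0 → ∃ D ⊆ T, G.bd D = τ := fun τ hτ =>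
    mem_cspan.1 (hTs ▸ mem_cspan_of_sum_eq_zero hconn hτ)
  obtain ⟨K, hKT, hK⟩ := hspan _ (sum_bd_univ Pᶜ)
  have hKP := hKT.trans hTP
  have hNK : Disjoint Pᶜ K := Finset.disjoint_of_subset_right hKP disjoint_compl_left
  have hbH : G.bd (Pᶜ ∪ K) = 0 := by rw [bd_union hNK, hK, add_self_zmod2]
  have hHc := Finset.card_union_of_disjoint hNK
  have hHev : Even (G.negEdges (Pᶜ ∪ K)).card := by
    rw [← ZMod.natCast_eq_zero_iff_even, ← hPpar _ hbH, ZMod.natCast_eq_zero_iff_even]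
    have : (Pᶜ ∪ K) \ P = Pᶜ := by
      ext e
      have := @hKP e
      simp only [Finset.mem_sdiff, Finset.mem_union, Finset.mem_compl]
      tauto
    rwa [this, hNc]
  obtain ⟨τ, hτ, hcovH⟩ := exists_terminals _ hbH hHev
  obtain ⟨J, hJ, hJk, hJ2⟩ : ∃ J, G.bd J = τ ∧ J.card ≤ T.card ∧
      2 * J.card + K.card ≤ 2 * T.card + G.negativeness := by
    obtain ⟨J, hJT, hJ⟩ := hspan τ hτ
    have h1 := card_add_card_symmDiff J (Pᶜ ∪ K)
    have h2 : (J ∪ (Pᶜ ∪ K)).card ≤ T.card + (Pᶜ).card :=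
      (Finset.card_le_card (t := T ∪ Pᶜ) (by
        intro e
        have := @hJT e
        have := @hKT e
        simp only [Finset.mem_union]
        tauto)).trans (Finset.card_union_le _ _)
    have h3 := Finset.card_le_card hJT
    by_cases h : J.card ≤ (symmDiff J (Pᶜ ∪ K)).card
    · exact ⟨J, hJ, h3, by omega⟩
    · exact ⟨symmDiff J (Pᶜ ∪ K), by rw [bd_symmDiff, hJ, hbH, add_zero], by omega, by omega⟩
  have hbridge : ∀ U e, G.boundary P U = {e} → e ∈ K := by
    intro U e hU
    by_contra heK
    have hcut := hPcut U
    rw [hU, Finset.card_singleton] at hcut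
    have heP : e ∈ G.boundary P U := by simp [hU]
    rw [boundary, Finset.mem_filter] at heP
    have heU : e ∈ G.boundary Finset.univ U := by simp [boundary, heP.2]
    obtain ⟨n, hn, hne⟩ : ∃ n ∈ G.boundary Finset.univ U, n ≠ e := by
      by_contra! hall
      exact hbr e ⟨U, Finset.eq_singleton_iff_unique_mem.2 ⟨heU, hall⟩⟩
    have hnP : n ∉ P := fun hnP => hne (Finset.mem_singleton.1 (hU ▸ Finset.mem_filter.2
      ⟨hnP, (Finset.mem_filter.1 hn).2⟩))
    have hsub : G.boundary (Pᶜ ∪ K) U ⊆ (G.boundary Finset.univ U).erase e := by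
      intro f hf
      rw [boundary, Finset.mem_filter, Finset.mem_union, Finset.mem_compl] at hf
      refine Finset.mem_erase.2 ⟨?_, by simp [boundary, hf.2]⟩
      rintro rfl
      exact hf.1.elim (fun h => h heP.1) heK
    have hle := Finset.card_le_card hsub
    rw [Finset.card_erase_of_mem heU] at hle
    have hpos : 0 < (G.boundary (Pᶜ ∪ K) U).card := Finset.card_pos.2 ⟨n, Finset.mem_filter.2
      ⟨by simp [hnP], (Finset.mem_filter.1 hn).2⟩⟩
    obtain ⟨m, hm⟩ := even_boundary hbH U
    omega
  obtain ⟨X, Y, W, hX, hY, hW, hbX, hbY, hbW, hcov, hq1, hq2⟩ :=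
    exists_even_cover hconn hKP (hTi.mono (Finset.coe_subset.2 hKT)) hbridge
  have hbal : ∀ C ⊆ P, G.IsCircuit C → Even (G.negEdges C).card := by
    intro C hC hCc
    rw [← ZMod.natCast_eq_zero_iff_even, ← hPpar _ hCc.bd_eq, Finset.sdiff_eq_empty_iff_subset.2 hC]
    simp
  obtain ⟨F₀, hF₀, hc₀, hl₀⟩ := hcovH J hJ
  obtain ⟨F₁, hF₁, hc₁, hl₁⟩ := exists_balanced_cover hbX fun C hC => hbal C (hC.trans hX)
  obtain ⟨F₂, hF₂, hc₂, hl₂⟩ := exists_balanced_cover hbY fun C hC => hbal C (hC.trans hY)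
  obtain ⟨F₃, hF₃, hc₃, hl₃⟩ := exists_balanced_cover hbW fun C hC => hbal C (hC.trans hW)
  have hSCC : G.SCC ≤ G.coverLength (F₀ + F₁ + F₂ + F₃) := by
    refine SCC_le ?_ fun e => ?_
    · intro S hS
      simp only [Multiset.mem_add] at hS
      rcases hS with ((hS | hS) | hS) | hS
      exacts [hF₀ S hS, hF₁ S hS, hF₂ S hS, hF₃ S hS]
    · have : e ∈ Pᶜ ∪ K ∨ e ∈ X ∪ Y ∪ W := by
        rw [or_iff_not_imp_left]
        intro he
        exact hcov (by simpa using he)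
      rw [Finset.mem_union (s := X ∪ Y), Finset.mem_union (s := X)] at this
      simp only [Multiset.mem_add]
      rcases this with he | (he | he) | he
      · obtain ⟨S, hS, h⟩ := hc₀ e he
        exact ⟨S, by simp [hS], h⟩
      · obtain ⟨S, hS, h⟩ := hc₁ e he
        exact ⟨S, by simp [hS], h⟩
      · obtain ⟨S, hS, h⟩ := hc₂ e he
        exact ⟨S, by simp [hS], h⟩
      · obtain ⟨S, hS, h⟩ := hc₃ e he
        exact ⟨S, by simp [hS], h⟩
  simp only [coverLength_add] at hSCC
  have hKc := Finset.card_le_card hKT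
  refine ⟨P.card, G.rk P, X.card + Y.card + W.card, K.card, J.card, hPc, rk_lt_card_V P,
    rk_le_card P, ?_, ?_, ?_, hq1, hq2, ?_⟩ <;> omega

end SignedMultigraph

/-- Let `G` be an s-bridgeless 2-edge-connected signed graph whose
negativeness `ε_N(G)` is positive and even. Then
`SCC(G) ≤ |E| + 2|V| + min{(2/3)|E| + (1/3)ε_N(G) − 4, |V| + ε_N(G) − 5}`. -/
theorem scc_of_twoEdgeConnected (G : SignedMultigraph) (hG : G.SBridgeless)
    (h2ec : G.TwoEdgeConnected) (hneg : 0 < G.negativeness)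
    (heven : Even G.negativeness) :
    (G.SCC : ℝ) ≤ (Fintype.card G.E : ℝ) + 2 * (Fintype.card G.V : ℝ) +
      min ((2 / 3 : ℝ) * (Fintype.card G.E : ℝ) + (1 / 3 : ℝ) * (G.negativeness : ℝ) - 4)
        ((Fintype.card G.V : ℝ) + (G.negativeness : ℝ) - 5) := by
  obtain ⟨p, k, q, h, j, hp, hk, hkp, hhk, hjk, hj, hq1, hq2, hS⟩ :=
    SignedMultigraph.exists_SCC_le h2ec heven
  have hε : 2 ≤ G.negativeness := by
    obtain ⟨n, hn⟩ := heven
    omega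
  have hA : 3 * G.SCC + 12 ≤
      5 * Fintype.card G.E + 6 * Fintype.card G.V + G.negativeness := by
    by_cases hk4 : 4 ≤ k
    · omega
    · obtain hx | ⟨x, rfl⟩ : q ≤ p ∨ ∃ x, q = p + x :=
        (le_total q p).imp_right Nat.exists_eq_add_of_le
      · interval_cases k <;> omega
      · have hx : x ≤ 5 := by omega
        interval_cases x <;> interval_cases k <;> omega
  have hB : G.SCC + 5 ≤ Fintype.card G.E + 3 * Fintype.card G.V + G.negativeness := by omega
  have hA' : 3 * (G.SCC : ℝ) + 12 ≤
      5 * (Fintype.card G.E : ℝ) + 6 * (Fintype.card G.V : ℝ) + (G.negativeness : ℝ) := by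
    exact_mod_cast hA
  have hB' : (G.SCC : ℝ) + 5 ≤
      (Fintype.card G.E : ℝ) + 3 * (Fintype.card G.V : ℝ) + (G.negativeness : ℝ) := by
    exact_mod_cast hB
  rw [← sub_le_iff_le_add', le_min_iff]
  constructor <;> linarith
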